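/- arXiv:1512.09211 — 3 statements merged into one kernel-verified Lean document; each statement's English description precedes it below -/
import Mathlib

section
/- Corollary 2 (lower bound): Let N ≥ 4 and let |ψ⟩ be an N-qubit pure state on qubits A, B, C₁, C₂, …, C_{N−2}. Then C²(|ψ⟩_{ABC₁|C₂…C_{N−2}}) ≥ C²(ρ_{AC₁}) + C²(ρ_{BC₁}) + Σ_{i=2}^{N−2} C²(ρ_{C₁C_i}) − 2·C_a²(ρ_{AB}) − Σ_{i=1}^{N−2} ( C_a²(ρ_{AC_i}) + C_a²(ρ_{BC_i}) ), where the ρ's are the two-qubit reduced density matrices of |ψ⟩⟨ψ|. -/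
open scoped BigOperators

noncomputable section

/-- Partial trace over the second tensor factor:
`(ptraceRight ρ) s s' = ∑ t, ρ (s,t) (s',t)`. -/
def ptraceRight {S T : Type*} [Fintype S] [Fintype T]
    (ρ : Matrix (S × T) (S × T) ℂ) : Matrix S S ℂ :=
  fun s s' => ∑ t : T, ρ (s, t) (s', t)

/-- Partial trace over the first tensor factor. -/
def ptraceLeft {S T : Type*} [Fintype S] [Fintype T]
    (ρ : Matrix (S × T) (S × T) ℂ) : Matrix T T ℂ :=
  fun t t' => ∑ s : S, ρ (s, t) (s, t')

/-- The density matrix `|ψ⟩⟨ψ|` of a (pure) state vector `ψ`. -/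
def pureDM {d : Type*} (ψ : d → ℂ) : Matrix d d ℂ :=
  fun x y => ψ x * (starRingEnd ℂ) (ψ y)

/-- `Tr(ρ²)` (real part) of a square matrix. -/
def trSq {S : Type*} [Fintype S] (ρ : Matrix S S ℂ) : ℝ :=
  ((ρ * ρ).trace).re

/-- Linear entropy `T(ρ) = 1 - Tr(ρ²)`. -/
def linEnt {S : Type*} [Fintype S] (ρ : Matrix S S ℂ) : ℝ :=
  1 - trSq ρ

/-- Concurrence of a bipartite pure state `ψ : S × T → ℂ` (with respect to the
bipartition `S | T`): `C(ψ) = √(2 (1 - Tr ρ_S²))`. -/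
def pureConc {S T : Type*} [Fintype S] [Fintype T] (ψ : S × T → ℂ) : ℝ :=
  Real.sqrt (2 * (1 - trSq (ptraceRight (pureDM ψ))))

/-- The set of average pure-state concurrences over all finite pure-state
ensembles realizing the bipartite density matrix `ρ`. -/
def concSet {S T : Type*} [Fintype S] [Fintype T]
    (ρ : Matrix (S × T) (S × T) ℂ) : Set ℝ :=
  { c | ∃ (n : ℕ) (p : Fin n → ℝ) (φ : Fin n → S × T → ℂ),
      (∀ i, 0 ≤ p i) ∧ (∑ i, p i = 1) ∧
      (∀ i, ∑ x, ‖φ i x‖ ^ 2 = 1) ∧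
      (ρ = ∑ i, (p i : ℂ) • pureDM (φ i)) ∧
      c = ∑ i, p i * pureConc (φ i) }

/-- Concurrence of a bipartite mixed state (convex-roof extension). -/
def conc {S T : Type*} [Fintype S] [Fintype T]
    (ρ : Matrix (S × T) (S × T) ℂ) : ℝ :=
  sInf (concSet ρ)

/-- Concurrence of assistance of a bipartite mixed state. -/
def concA {S T : Type*} [Fintype S] [Fintype T]
    (ρ : Matrix (S × T) (S × T) ℂ) : ℝ :=
  sSup (concSet ρ)

/-- Concurrence of an `N`-qubit pure state `ψ` across the cut given by the
predicate `P` (the qubits satisfying `P` versus the rest). -/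
def qubitCut {N : ℕ} (P : Fin N → Prop) [DecidablePred P]
    (ψ : (Fin N → Fin 2) → ℂ) : ℝ :=
  pureConc (fun x : ({i // P i} → Fin 2) × ({i // ¬ P i} → Fin 2) =>
    ψ ((Equiv.piEquivPiSubtypeProd P (fun _ => Fin 2)).symm x))

/-- Assemble a full `N`-qubit configuration from values `x` at qubit `u`,
`y` at qubit `v`, and `f` elsewhere. -/
def assemble2 {N : ℕ} (u v : Fin N) (x y : Fin 2)
    (f : {i : Fin N // i ≠ u ∧ i ≠ v} → Fin 2) : Fin N → Fin 2 :=
  fun i => if h : i = u then x else if h' : i = v then y else f ⟨i, h, h'⟩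

/-- The two-qubit reduced density matrix of the `N`-qubit pure state `ψ` on the
(ordered) pair of qubits `u, v`, obtained by tracing out all other qubits. -/
def rdm2 {N : ℕ} (u v : Fin N) (ψ : (Fin N → Fin 2) → ℂ) :
    Matrix (Fin 2 × Fin 2) (Fin 2 × Fin 2) ℂ :=
  fun x y => ∑ f : {i : Fin N // i ≠ u ∧ i ≠ v} → Fin 2,
    ψ (assemble2 u v x.1 x.2 f) * (starRingEnd ℂ) (ψ (assemble2 u v y.1 y.2 f))

/-- The reduced density matrix of the `N`-qubit pure state `ψ` obtained by
tracing out the single qubit `v`, organized as a bipartite state on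
qubit `u` versus all remaining qubits. -/
def rdm1Rest {N : ℕ} (u v : Fin N) (ψ : (Fin N → Fin 2) → ℂ) :
    Matrix (Fin 2 × ({i : Fin N // i ≠ u ∧ i ≠ v} → Fin 2))
           (Fin 2 × ({i : Fin N // i ≠ u ∧ i ≠ v} → Fin 2)) ℂ :=
  fun x y => ∑ t : Fin 2,
    ψ (assemble2 u v x.1 t x.2) * (starRingEnd ℂ) (ψ (assemble2 u v y.1 t y.2))

/-- A conjugate-linear symmetric map on a nonzero finite-dimensional space has a unit vector which
it maps to a real multiple of itself. -/
lemma exists_unit_coneigenvector {V : Type*} [NormedAddCommGroup V] [InnerProductSpace ℂ V]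
    [FiniteDimensional ℂ V] [Nontrivial V] (T : V →ₗ⋆[ℂ] V)
    (hT : ∀ x y, inner ℂ (T x) y = inner ℂ (T y) x) :
    ∃ (v : V) (μ : ℝ), ‖v‖ = 1 ∧ T v = (μ : ℂ) • v := by
  let _ : InnerProductSpace ℝ V := InnerProductSpace.rclikeToReal ℂ V
  have : FiniteDimensional ℝ V := FiniteDimensional.complexToReal V
  let R : V →ₗ[ℝ] V :=
    { toFun := T
      map_add' := map_add T
      map_smul' := fun r x => by
        have := T.map_smulₛₗ (r : ℂ) x
        simpa using this }
  have hR : R.IsSymmetric := fun x y => by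
    have h := congrArg Complex.re (hT x y)
    have h2 : (inner ℂ (T y) x).re = (inner ℂ x (T y)).re := inner_re_symm (𝕜 := ℂ) _ _
    rw [real_inner_eq_re_inner ℂ, real_inner_eq_re_inner ℂ]
    exact h.trans h2
  obtain ⟨v, hv⟩ := hR.hasEigenvalue_iSup_of_finiteDimensional.exists_hasEigenvector
  have hv0 : ‖v‖ ≠ 0 := norm_ne_zero_iff.2 hv.2
  generalize (⨆ x : { x : V // x ≠ 0 }, _ : ℝ) = μ at hv
  refine ⟨(‖v‖⁻¹ : ℝ) • v, μ, ?_, ?_⟩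
  · rw [norm_smul, norm_inv, norm_norm, inv_mul_cancel₀ hv0]
  · have h1 := hv.apply_eq_smul
    change R _ = _
    rw [map_smul, h1, smul_comm]
    exact (Complex.coe_smul _ _).symm

/-- Takagi factorization for conjugate-linear symmetric maps. -/
lemma exists_orthonormal_coneigenvectors (n : ℕ) :
    ∀ (V : Type) [NormedAddCommGroup V] [InnerProductSpace ℂ V] [FiniteDimensional ℂ V]
      (T : V →ₗ⋆[ℂ] V), (∀ x y, inner ℂ (T x) y = inner ℂ (T y) x) → Module.finrank ℂ V = n →
      ∃ (v : Fin n → V) (μ : Fin n → ℝ), Orthonormal ℂ v ∧ ∀ i, T (v i) = (μ i : ℂ) • v i := by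
  induction n with
  | zero => 
    intro V _ _ _ T hT hn
    exact ⟨Fin.elim0, Fin.elim0, ⟨fun i => i.elim0, fun i => i.elim0⟩, fun i => i.elim0⟩
  | succ n ih =>
    intro V _ _ _ T hT hn
    have : Nontrivial V := Module.nontrivial_of_finrank_pos (R := ℂ) (by omega)
    obtain ⟨v, μ, hv, hTv⟩ := exists_unit_coneigenvector T hT
    have hv0 : v ≠ 0 := fun h => by simp [h] at hv
    let W : Submodule ℂ V := (ℂ ∙ v)ᗮ
    have hW : ∀ x ∈ W, T x ∈ W := by
      intro x hx
      rw [Submodule.mem_orthogonal_singleton_iff_inner_left] at hx ⊢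
      rw [hT, hTv, inner_smul_left, inner_eq_zero_symm.1 hx, mul_zero]
    have hWn : Module.finrank ℂ W = n := by
      have : Fact (Module.finrank ℂ V = n + 1) := ⟨hn⟩
      exact Submodule.finrank_orthogonal_span_singleton hv0
    let S : W →ₗ⋆[ℂ] W := 
      { toFun := fun x => ⟨T x, hW x x.2⟩
        map_add' := fun x y => Subtype.ext (map_add T _ _)
        map_smul' := fun c x => Subtype.ext (T.map_smulₛₗ c x) }
    obtain ⟨w, ν, hw, hTw⟩ := ih W S (fun x y => hT x y) hWn
    refine ⟨Matrix.vecCons v (fun i => (w i : V)), Matrix.vecCons μ ν, ?_, ?_⟩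
    · rw [orthonormal_vecCons_iff]
      refine ⟨hv, fun i => ?_, hw.comp_linearIsometry W.subtypeₗᵢ⟩
      exact (Submodule.mem_orthogonal_singleton_iff_inner_right).1 (w i).2
    · intro i
      refine Fin.cases ?_ (fun j => ?_) i
      · simpa using hTv
      · have h : T (w j) = ((ν j : ℂ) • w j : W) := congrArg Subtype.val (hTw j)
        simpa using h

/-- Takagi factorization: a complex symmetric matrix is diagonalized, with nonnegative real
diagonal entries, by a unitary congruence. -/
lemma exists_takagi {κ : Type} [Fintype κ] [DecidableEq κ] (τ : Matrix κ κ ℂ)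
    (hτ : τ.transpose = τ) :
    ∃ U ∈ Matrix.unitaryGroup κ ℂ, ∃ μ : κ → ℝ, (∀ i, 0 ≤ μ i) ∧
      U * τ * U.transpose = Matrix.diagonal (fun i => (μ i : ℂ)) := by
  let T : EuclideanSpace ℂ κ →ₗ⋆[ℂ] EuclideanSpace ℂ κ :=
    { toFun := fun x => WithLp.toLp 2 (τ.mulVec (fun k => star (x k)))
      map_add' := fun x y => by
        ext i
        simp [Matrix.mulVec, dotProduct, mul_add, Finset.sum_add_distrib]
      map_smul' := fun c x => by
        ext i
        simp [Matrix.mulVec, dotProduct, Finset.mul_sum, mul_left_comm] }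
  have hT : ∀ x y, inner ℂ (T x) y = inner ℂ (T y) x := by
    intro x y
    simp only [PiLp.inner_apply, T, LinearMap.coe_mk, AddHom.coe_mk, Matrix.mulVec, dotProduct,
      RCLike.inner_apply, map_sum, Finset.mul_sum, map_mul]
    rw [Finset.sum_comm]
    refine Finset.sum_congr rfl fun i _ => Finset.sum_congr rfl fun j _ => ?_
    have := congrFun (congrFun hτ i) j
    rw [Matrix.transpose_apply] at this
    rw [this]
    simp
    ring
  obtain ⟨v, μ, hv, hTv⟩ := exists_orthonormal_coneigenvectors (Fintype.card κ) _ T hT (by simp)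
  let e := Fintype.equivFin κ
  -- multiplying a coneigenvector by `I` flips the sign of its coneigenvalue
  let c : κ → ℂ := fun i => if 0 ≤ μ (e i) then 1 else Complex.I
  let U : Matrix κ κ ℂ := Matrix.of fun i k => c i * star (v (e i) k)
  have hU : ∀ i k, U i k = c i * star (v (e i) k) := fun _ _ => rfl
  have hc : ∀ i, c i * star (c i) = 1 := by
    intro i; simp only [c]; split_ifs <;> simp
  have hcc : ∀ i, c i * c i * (μ (e i) : ℂ) = (|μ (e i)| : ℝ) := by
    intro i; simp only [c]; split_ifs with h
    · rw [abs_of_nonneg h]; simp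
    · rw [abs_of_neg (not_le.1 h)]; simp
  have hvv : ∀ i j, ∑ k, star (v (e i) k) * v (e j) k = if i = j then 1 else 0 := by
    intro i j
    have := (orthonormal_iff_ite.1 hv) (e i) (e j)
    simp only [PiLp.inner_apply, RCLike.inner_apply, e.injective.eq_iff] at this
    rw [← this]
    exact Finset.sum_congr rfl fun k _ => mul_comm _ _
  refine ⟨U, ?_, fun i => |μ (e i)|, fun i => abs_nonneg _, ?_⟩
  · rw [Matrix.mem_unitaryGroup_iff]
    ext i j
    simp only [Matrix.mul_apply, Matrix.star_apply, hU, star_mul', star_star, Matrix.one_apply]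
    have : ∑ x, c i * star (v (e i) x) * (star (c j) * v (e j) x) =
        c i * star (c j) * ∑ x, star (v (e i) x) * v (e j) x := by
      rw [Finset.mul_sum]; exact Finset.sum_congr rfl fun k _ => by ring
    rw [this, hvv]
    split_ifs with h
    · rw [h, mul_one, hc]
    · simp
  · ext i j
    have h1 : ∀ k, ∑ l, τ k l * star (v (e j) l) = μ (e j) * v (e j) k := by
      intro k
      have := congrArg (fun x : EuclideanSpace ℂ κ => x k) (hTv (e j))
      simpa [T, Matrix.mulVec, dotProduct] using this
    have h2 : (U * τ * U.transpose) i j =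
        c i * c j * (μ (e j) : ℂ) * ∑ k, star (v (e i) k) * v (e j) k := by
      rw [Matrix.mul_assoc]
      simp only [Matrix.mul_apply, hU, Matrix.transpose_apply, Finset.mul_sum]
      refine Finset.sum_congr rfl fun k _ => ?_
      calc _ = c i * star (v (e i) k) * (c j * ∑ l, τ k l * star (v (e j) l)) := by
              rw [Finset.mul_sum, Finset.mul_sum]; exact Finset.sum_congr rfl fun k _ => by ring
        _ = _ := by rw [h1]; ring
    rw [h2, hvv, Matrix.diagonal_apply]
    split_ifs with h
    · rw [h, mul_one, hcc]
    · simp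

open Matrix in
/-- Three pairwise anticommuting `2 × 2` complex matrices with square `-1` are simultaneously
conjugate to the standard quaternion units, up to the sign of the third. -/
lemma exists_quaternion_frame (h₁ h₂ h₃ : Matrix (Fin 2) (Fin 2) ℂ)
    (h11 : h₁ * h₁ = -1) (h22 : h₂ * h₂ = -1) (h33 : h₃ * h₃ = -1)
    (h12 : h₁ * h₂ = -(h₂ * h₁)) (h13 : h₁ * h₃ = -(h₃ * h₁)) (h23 : h₂ * h₃ = -(h₃ * h₂)) :
    ∃ (Q : Matrix (Fin 2) (Fin 2) ℂ) (β : ℂ), Q.det ≠ 0 ∧ β * β = -1 ∧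
      h₁ * Q = Q * !![Complex.I, 0; 0, -Complex.I] ∧ h₂ * Q = Q * !![0, -1; 1, 0] ∧
      h₃ * Q = Q * !![0, β; β, 0] := by
  have hinj : ∀ u, h₂ *ᵥ u = 0 → u = 0 := by
    intro u hu
    have : (h₂ * h₂) *ᵥ u = 0 := by rw [← mulVec_mulVec, hu, mulVec_zero]
    rw [h22, neg_mulVec, one_mulVec, neg_eq_zero] at this
    exact this
  have hanti : ∀ u, h₁ *ᵥ (h₂ *ᵥ u) = -(h₂ *ᵥ (h₁ *ᵥ u)) := by
    intro u; rw [mulVec_mulVec, mulVec_mulVec, h12, neg_mulVec]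
  obtain ⟨v, hv0, hv⟩ : ∃ v, v ≠ 0 ∧ h₁ *ᵥ v = Complex.I • v := by
    have hprod : (h₁ - Complex.I • 1) * (h₁ + Complex.I • 1) = 0 := by
      simp [sub_mul, mul_add, smul_sub, smul_smul, h11]
      abel
    have hdet := congrArg det hprod
    rw [det_mul, det_zero, mul_eq_zero] at hdet
    rcases hdet with hd | hd
    · obtain ⟨v, hv0, hv⟩ := exists_mulVec_eq_zero_iff.2 hd
      refine ⟨v, hv0, ?_⟩
      rw [sub_mulVec, smul_mulVec, one_mulVec] at hv
      exact sub_eq_zero.1 hv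
    · obtain ⟨v, hv0, hv⟩ := exists_mulVec_eq_zero_iff.2 hd
      rw [add_mulVec, smul_mulVec, one_mulVec] at hv
      refine ⟨h₂ *ᵥ v, fun h => hv0 (hinj v h), ?_⟩
      rw [hanti, eq_neg_of_add_eq_zero_left hv, mulVec_neg, mulVec_smul, neg_neg]
  set w := h₂ *ᵥ v with hw
  have hw1 : h₁ *ᵥ w = -(Complex.I • w) := by rw [hw, hanti, hv, mulVec_smul]
  have hw2 : h₂ *ᵥ w = -v := by rw [hw, mulVec_mulVec, h22, neg_mulVec, one_mulVec]
  have hw0 : w ≠ 0 := fun h => hv0 (hinj v h)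
  let Q : Matrix (Fin 2) (Fin 2) ℂ := !![v 0, w 0; v 1, w 1]
  have hQ1 : h₁ * Q = Q * !![Complex.I, 0; 0, -Complex.I] := by
    ext i j
    have a := congrFun hv i
    have b := congrFun hw1 i
    fin_cases i <;> fin_cases j <;>
      simp [Q, mulVec, dotProduct, mul_apply, Fin.sum_univ_two] at a b ⊢ <;>
      first | linear_combination a | linear_combination b
  have hQ2 : h₂ * Q = Q * !![0, -1; 1, 0] := by
    ext i j
    have a := congrFun hw.symm i
    have b := congrFun hw2 i
    fin_cases i <;> fin_cases j <;>
      simp [Q, mulVec, dotProduct, mul_apply, Fin.sum_univ_two] at a b ⊢ <;>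
      first | linear_combination a | linear_combination b
  have hQ : Q.det ≠ 0 := by
    intro h0
    obtain ⟨c, hc0, hc⟩ := exists_mulVec_eq_zero_iff.2 h0
    have e1 : c 0 • v + c 1 • w = 0 := by
      ext i
      have := congrFun hc i
      fin_cases i <;> simp [Q, mulVec, dotProduct, Fin.sum_univ_two] at this ⊢ <;>
        linear_combination this
    have e2 := congrArg (h₁ *ᵥ ·) e1
    simp only [mulVec_add, mulVec_smul, hv, hw1, mulVec_zero] at e2
    have e3 : (2 * Complex.I * c 0) • v = 0 := by
      have : (2 * Complex.I * c 0) • v =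
          Complex.I • (c 0 • v + c 1 • w) + (c 0 • Complex.I • v + c 1 • -(Complex.I • w)) := by
        module
      rw [this, e1, e2, smul_zero, add_zero]
    have c0 : c 0 = 0 := by simpa [hv0] using e3
    have c1 : c 1 = 0 := by simpa [c0, hw0] using e1
    apply hc0
    ext i
    fin_cases i <;> simp [c0, c1]
  have hu : IsUnit Q.det := isUnit_iff_ne_zero.2 hQ
  set X := Q⁻¹ * (h₃ * Q) with hX
  have hQX : h₃ * Q = Q * X := by rw [hX, mul_nonsing_inv_cancel_left _ _ hu]
  have hcancel : ∀ M M' : Matrix (Fin 2) (Fin 2) ℂ, Q * M = Q * M' → M = M' := fun M M' h => by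
    rw [← nonsing_inv_mul_cancel_left _ M hu, h, nonsing_inv_mul_cancel_left _ M' hu]
  have hDX : !![Complex.I, 0; 0, -Complex.I] * X = -(X * !![Complex.I, 0; 0, -Complex.I]) := by
    apply hcancel
    rw [← Matrix.mul_assoc, ← hQ1, Matrix.mul_assoc, ← hQX, ← Matrix.mul_assoc, h13,
      Matrix.neg_mul, Matrix.mul_assoc, hQ1, ← Matrix.mul_assoc, hQX, Matrix.mul_neg,
      Matrix.mul_assoc]
  have hYX : !![0, -1; 1, 0] * X = -(X * !![0, -1; 1, 0]) := by
    apply hcancel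
    rw [← Matrix.mul_assoc, ← hQ2, Matrix.mul_assoc, ← hQX, ← Matrix.mul_assoc, h23,
      Matrix.neg_mul, Matrix.mul_assoc, hQ2, ← Matrix.mul_assoc, hQX, Matrix.mul_neg,
      Matrix.mul_assoc]
  have hXX : X * X = -1 := by
    apply hcancel
    rw [← Matrix.mul_assoc, ← hQX, Matrix.mul_assoc, ← hQX, ← Matrix.mul_assoc, h33]
    simp
  have x00 : X 0 0 = 0 := by
    have := congrFun (congrFun hDX 0) 0
    simp [mul_apply, Fin.sum_univ_two] at this
    have h2 : (2 * Complex.I) * X 0 0 = 0 := by linear_combination this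
    simpa using h2
  have x11 : X 1 1 = 0 := by
    have := congrFun (congrFun hDX 1) 1
    simp [mul_apply, Fin.sum_univ_two] at this
    have h2 : (2 * Complex.I) * X 1 1 = 0 := by linear_combination -this
    simpa using h2
  have x10 : X 1 0 = X 0 1 := by
    have := congrFun (congrFun hYX 0) 0
    simp [mul_apply, Fin.sum_univ_two] at this
    exact this
  have xx : X 0 1 * X 0 1 = -1 := by
    have := congrFun (congrFun hXX 0) 0
    simp [mul_apply, Fin.sum_univ_two, x00, x10] at this
    exact this
  refine ⟨Q, X 0 1, hQ, xx, hQ1, hQ2, ?_⟩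
  rw [hQX]
  congr 1
  ext i j
  fin_cases i <;> fin_cases j <;> simp [x00, x11, x10]

open Matrix in
/-- A traceless `2 × 2` matrix of determinant one squares to `-1`. -/
lemma mul_self_eq_neg_one_of_trace_eq_zero (h : Matrix (Fin 2) (Fin 2) ℂ) (ht : h.trace = 0)
    (hd : h.det = 1) : h * h = -1 := by
  simp only [det_fin_two, trace_fin_two] at hd ht
  ext i j
  fin_cases i <;> fin_cases j <;> simp [mul_apply, Fin.sum_univ_two]
  all_goals grind

open Matrix in
/-- Traceless `2 × 2` matrices orthogonal for the polarized determinant anticommute. -/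
lemma mul_eq_neg_mul_of_trace_eq_zero (h k : Matrix (Fin 2) (Fin 2) ℂ) (hh : h.trace = 0)
    (hk : k.trace = 0) (hhk : (h.adjugate * k).trace = 0) : h * k = -(k * h) := by
  simp only [adjugate_fin_two, trace_fin_two, mul_apply, Fin.sum_univ_two, of_apply,
    cons_val', cons_val_zero, cons_val_one, cons_val_fin_one] at hh hk hhk
  ext i j
  fin_cases i <;> fin_cases j <;> simp [mul_apply, Fin.sum_univ_two]
  all_goals grind

open Matrix in
/-- Four `2 × 2` matrices which are orthonormal for the polarized determinant are simultaneously
equivalent to the standard quaternion units. -/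
lemma exists_simultaneous_equivalence (g₀ g₁ g₂ g₃ : Matrix (Fin 2) (Fin 2) ℂ)
    (d0 : g₀.det = 1) (d1 : g₁.det = 1) (d2 : g₂.det = 1) (d3 : g₃.det = 1)
    (t01 : (g₀.adjugate * g₁).trace = 0) (t02 : (g₀.adjugate * g₂).trace = 0)
    (t03 : (g₀.adjugate * g₃).trace = 0) (t12 : (g₁.adjugate * g₂).trace = 0)
    (t13 : (g₁.adjugate * g₃).trace = 0) (t23 : (g₂.adjugate * g₃).trace = 0) :
    ∃ (A Q : Matrix (Fin 2) (Fin 2) ℂ) (β : ℂ), Q.det ≠ 0 ∧ A.det = Q.det ∧ β * β = -1 ∧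
      g₀ * Q = A ∧ g₁ * Q = A * !![Complex.I, 0; 0, -Complex.I] ∧
      g₂ * Q = A * !![0, -1; 1, 0] ∧ g₃ * Q = A * !![0, β; β, 0] := by
  have hsq : ∀ g : Matrix (Fin 2) (Fin 2) ℂ, g.det = 1 → (g₀.adjugate * g).trace = 0 →
      (g₀.adjugate * g) * (g₀.adjugate * g) = -1 := by
    intro g hd ht
    refine mul_self_eq_neg_one_of_trace_eq_zero _ ht ?_
    rw [det_mul, det_adjugate, d0, hd]; simp
  have hanti : ∀ g g' : Matrix (Fin 2) (Fin 2) ℂ, (g₀.adjugate * g).trace = 0 →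
      (g₀.adjugate * g').trace = 0 → (g.adjugate * g').trace = 0 →
      (g₀.adjugate * g) * (g₀.adjugate * g') = -((g₀.adjugate * g') * (g₀.adjugate * g)) := by
    intro g g' ht ht' htt
    refine mul_eq_neg_mul_of_trace_eq_zero _ _ ht ht' ?_
    rw [adjugate_mul_distrib, adjugate_adjugate g₀ (by simp), d0, one_pow, one_smul,
      Matrix.mul_assoc, ← Matrix.mul_assoc _ g₀.adjugate, mul_adjugate, d0, one_smul,
      Matrix.one_mul, htt]
  obtain ⟨Q, β, hQ, hβ, h1, h2, h3⟩ := exists_quaternion_frame _ _ _ (hsq g₁ d1 t01) (hsq g₂ d2 t02)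
    (hsq g₃ d3 t03) (hanti g₁ g₂ t01 t02 t12) (hanti g₁ g₃ t01 t03 t13) (hanti g₂ g₃ t02 t03 t23)
  have hg : ∀ g : Matrix (Fin 2) (Fin 2) ℂ, g₀ * (g₀.adjugate * g) = g := by
    intro g; rw [← Matrix.mul_assoc, mul_adjugate, d0, one_smul, Matrix.one_mul]
  refine ⟨g₀ * Q, Q, β, hQ, by rw [det_mul, d0, one_mul], hβ, rfl, ?_, ?_, ?_⟩
  · rw [Matrix.mul_assoc, ← h1, ← Matrix.mul_assoc, hg]
  · rw [Matrix.mul_assoc, ← h2, ← Matrix.mul_assoc, hg]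
  · rw [Matrix.mul_assoc, ← h3, ← Matrix.mul_assoc, hg]

open Matrix in
/-- A traceless Hermitian `2 × 2` matrix is a real multiple of a unitary conjugate of
`diag(1, -1)`. -/
lemma exists_unitary_conj_diag (E : Matrix (Fin 2) (Fin 2) ℂ) (hE : E.IsHermitian)
    (ht : E.trace = 0) :
    ∃ V ∈ unitaryGroup (Fin 2) ℂ, ∃ r : ℝ,
      E = (r : ℂ) • (V * !![1, 0; 0, -1] * Vᴴ) ∧ E.det = -(r : ℂ) ^ 2 := by
  have hs := hE.spectral_theorem
  have hd := hE.det_eq_prod_eigenvalues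
  have htr := hE.trace_eq_sum_eigenvalues
  rw [ht, Fin.sum_univ_two] at htr
  rw [Fin.prod_univ_two] at hd
  set e := hE.eigenvalues
  have he : (e 1 : ℂ) = -(e 0 : ℂ) := by
    simp only [Complex.coe_algebraMap] at htr
    linear_combination -htr
  refine ⟨hE.eigenvectorUnitary, hE.eigenvectorUnitary.2, e 0, ?_, ?_⟩
  · have hdiag : (diagonal (RCLike.ofReal ∘ e) : Matrix (Fin 2) (Fin 2) ℂ) =
        (e 0 : ℂ) • !![1, 0; 0, -1] := by
      ext i j
      fin_cases i <;> fin_cases j <;> simp [he]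
    rw [hdiag] at hs
    rw [Unitary.conjStarAlgAut_apply] at hs
    nth_rewrite 1 [hs]
    rw [Matrix.mul_smul, Matrix.smul_mul, star_eq_conjTranspose]
  · rw [hd]; simp only [Complex.coe_algebraMap, he]; ring

lemma exists_real_pair_of_linear (a b : ℝ) : ∃ x y : ℝ, 0 < x ^ 2 + y ^ 2 ∧ x * a + y * b = 0 := by
  by_cases h : a = 0 ∧ b = 0
  · exact ⟨1, 0, by norm_num, by simp [h.1]⟩
  · refine ⟨b, -a, ?_, by ring⟩
    rcases not_and_or.1 h with h | h
    · nlinarith [sq_nonneg b, pow_pos (sq_pos_of_ne_zero h) 1]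
    · nlinarith [sq_nonneg a, sq_pos_of_ne_zero h]

open Matrix in
/-- For four `2 × 2` matrices orthogonal for the polarized determinant, some unitary conjugate of
`diag(1, -1)` is mapped to a matrix with a determinant given by two signed sums. -/
lemma exists_unitary_det_eq (p₀ p₁ p₂ p₃ : Matrix (Fin 2) (Fin 2) ℂ) (r₀ r₁ r₂ r₃ : ℝ)
    (hr₀ : 0 < r₀) (hr₁ : 0 < r₁) (hr₂ : 0 < r₂) (hr₃ : 0 < r₃)
    (d0 : p₀.det = (r₀ : ℂ) ^ 2) (d1 : p₁.det = (r₁ : ℂ) ^ 2) (d2 : p₂.det = (r₂ : ℂ) ^ 2)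
    (d3 : p₃.det = (r₃ : ℂ) ^ 2)
    (t01 : (p₀.adjugate * p₁).trace = 0) (t02 : (p₀.adjugate * p₂).trace = 0)
    (t03 : (p₀.adjugate * p₃).trace = 0) (t12 : (p₁.adjugate * p₂).trace = 0)
    (t13 : (p₁.adjugate * p₃).trace = 0) (t23 : (p₂.adjugate * p₃).trace = 0) :
    ∃ V ∈ unitaryGroup (Fin 2) ℂ, ∃ x y : ℝ, 0 < x ^ 2 + y ^ 2 ∧
      ((x ^ 2 + y ^ 2 : ℝ) : ℂ) * (p₀ * (V * !![1, 0; 0, -1] * Vᴴ) * p₀ᴴ +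
        p₁ * (V * !![1, 0; 0, -1] * Vᴴ) * p₁ᴴ + p₂ * (V * !![1, 0; 0, -1] * Vᴴ) * p₂ᴴ +
        p₃ * (V * !![1, 0; 0, -1] * Vᴴ) * p₃ᴴ).det =
      -((x ^ 2 * (r₀ ^ 2 + r₁ ^ 2 - r₂ ^ 2 - r₃ ^ 2) ^ 2 +
        y ^ 2 * (r₀ ^ 2 - r₁ ^ 2 - r₂ ^ 2 + r₃ ^ 2) ^ 2 : ℝ) : ℂ) := by
  have hdet : ∀ (p : Matrix (Fin 2) (Fin 2) ℂ) (r : ℝ), 0 < r → p.det = (r : ℂ) ^ 2 →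
      ((r : ℂ)⁻¹ • p).det = 1 := by
    intro p r hr hd
    have : (r : ℂ) ≠ 0 := by exact_mod_cast hr.ne'
    rw [det_smul, hd, Fintype.card_fin]; field_simp
  have htr : ∀ (p q : Matrix (Fin 2) (Fin 2) ℂ) (r s : ℂ), (p.adjugate * q).trace = 0 →
      ((r • p).adjugate * (s • q)).trace = 0 := by
    intro p q r s h
    rw [adjugate_smul, Matrix.smul_mul, Matrix.mul_smul, trace_smul, trace_smul, h]; simp
  obtain ⟨A, Q, β, hQ, hAQ, hβ, e0, e1, e2, e3⟩ := exists_simultaneous_equivalence _ _ _ _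
    (hdet p₀ r₀ hr₀ d0) (hdet p₁ r₁ hr₁ d1) (hdet p₂ r₂ hr₂ d2) (hdet p₃ r₃ hr₃ d3)
    (htr _ _ _ _ t01) (htr _ _ _ _ t02) (htr _ _ _ _ t03) (htr _ _ _ _ t12) (htr _ _ _ _ t13)
    (htr _ _ _ _ t23)
  obtain ⟨x, y, hxy, hlin⟩ := exists_real_pair_of_linear
    (Complex.normSq (Q 0 0) + Complex.normSq (Q 1 0) - Complex.normSq (Q 0 1) -
      Complex.normSq (Q 1 1))
    (2 * (Q 0 0 * star (Q 0 1) + Q 1 0 * star (Q 1 1)).re)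
  set F : Matrix (Fin 2) (Fin 2) ℂ := !![(x : ℂ), y; y, -x] with hF
  have hFH : Fᴴ = F := by
    ext i j; fin_cases i <;> fin_cases j <;> simp [hF]
  have hE : (Q * F * Qᴴ).IsHermitian := by
    rw [IsHermitian, conjTranspose_mul, conjTranspose_mul, conjTranspose_conjTranspose, hFH,
      Matrix.mul_assoc]
  have hEt : (Q * F * Qᴴ).trace = 0 := by
    have := congrArg (fun t : ℝ => (t : ℂ)) hlin
    apply Complex.ext
    · simp [hF, trace_fin_two, mul_apply, Fin.sum_univ_two]
      simp [Complex.normSq_apply] at hlin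
      linear_combination hlin
    · simp [hF, trace_fin_two, mul_apply, Fin.sum_univ_two]
      ring
  obtain ⟨V, hV, r, hVr, hVd⟩ := exists_unitary_conj_diag _ hE hEt
  refine ⟨V, hV, x, y, hxy, ?_⟩
  have hβc : β * star β = 1 := by
    have h1 : ‖β‖ * ‖β‖ = 1 := by rw [← norm_mul, hβ]; simp
    have h2 : β * star β = ((‖β‖ * ‖β‖ : ℝ) : ℂ) := by
      rw [Complex.star_def, Complex.mul_conj, Complex.normSq_eq_norm_sq]; push_cast; ring
    rw [h2, h1]; simp
  have hpq : ∀ (p q : Matrix (Fin 2) (Fin 2) ℂ) (s : ℝ), 0 < s → ((s : ℂ)⁻¹ • p) * Q = A * q →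
      p * (Q * F * Qᴴ) * pᴴ = A * (((s : ℂ) ^ 2) • (q * F * qᴴ)) * Aᴴ := by
    intro p q s hs h
    have hs' : (s : ℂ) ≠ 0 := by exact_mod_cast hs.ne'
    have h' : p * Q = (s : ℂ) • (A * q) := by
      rw [← h, Matrix.smul_mul, smul_smul, mul_inv_cancel₀ hs', one_smul]
    have : p * (Q * F * Qᴴ) * pᴴ = (p * Q) * F * (p * Q)ᴴ := by
      simp only [conjTranspose_mul, Matrix.mul_assoc]
    rw [this, h', conjTranspose_smul, conjTranspose_mul]
    simp only [Matrix.smul_mul, Matrix.mul_smul, Matrix.mul_assoc, smul_smul]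
    simp [pow_two]
  have hsum : p₀ * (Q * F * Qᴴ) * p₀ᴴ + p₁ * (Q * F * Qᴴ) * p₁ᴴ + p₂ * (Q * F * Qᴴ) * p₂ᴴ +
      p₃ * (Q * F * Qᴴ) * p₃ᴴ =
      A * !![((x * (r₀ ^ 2 + r₁ ^ 2 - r₂ ^ 2 - r₃ ^ 2) : ℝ) : ℂ),
          ((y * (r₀ ^ 2 - r₁ ^ 2 - r₂ ^ 2 + r₃ ^ 2) : ℝ) : ℂ);
        ((y * (r₀ ^ 2 - r₁ ^ 2 - r₂ ^ 2 + r₃ ^ 2) : ℝ) : ℂ),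
          -((x * (r₀ ^ 2 + r₁ ^ 2 - r₂ ^ 2 - r₃ ^ 2) : ℝ) : ℂ)] * Aᴴ := by
    rw [hpq p₀ 1 r₀ hr₀ (by rw [e0, Matrix.mul_one]), hpq p₁ _ r₁ hr₁ e1, hpq p₂ _ r₂ hr₂ e2,
      hpq p₃ _ r₃ hr₃ e3]
    simp only [← Matrix.add_mul, ← Matrix.mul_add]
    congr 2
    have c1 : (!![Complex.I, 0; 0, -Complex.I] : Matrix (Fin 2) (Fin 2) ℂ)ᴴ =
        !![-Complex.I, 0; 0, Complex.I] := by
      ext i j; fin_cases i <;> fin_cases j <;> simp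
    have c2 : (!![0, -1; 1, 0] : Matrix (Fin 2) (Fin 2) ℂ)ᴴ = !![0, 1; -1, 0] := by
      ext i j; fin_cases i <;> fin_cases j <;> simp
    have c3 : (!![0, β; β, 0] : Matrix (Fin 2) (Fin 2) ℂ)ᴴ = !![0, star β; star β, 0] := by
      ext i j; fin_cases i <;> fin_cases j <;> simp
    have hI := Complex.I_mul_I
    rw [c1, c2, c3, conjTranspose_one]
    ext i j
    fin_cases i <;> fin_cases j <;> simp [hF] <;> simp at hβc <;> grind
  have hscale : p₀ * (Q * F * Qᴴ) * p₀ᴴ + p₁ * (Q * F * Qᴴ) * p₁ᴴ + p₂ * (Q * F * Qᴴ) * p₂ᴴ +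
      p₃ * (Q * F * Qᴴ) * p₃ᴴ = (r : ℂ) • (p₀ * (V * !![1, 0; 0, -1] * Vᴴ) * p₀ᴴ +
        p₁ * (V * !![1, 0; 0, -1] * Vᴴ) * p₁ᴴ + p₂ * (V * !![1, 0; 0, -1] * Vᴴ) * p₂ᴴ +
        p₃ * (V * !![1, 0; 0, -1] * Vᴴ) * p₃ᴴ) := by
    rw [hVr]; simp only [Matrix.mul_smul, Matrix.smul_mul, smul_add]
  rw [hsum] at hscale
  have hd := congrArg det hscale
  rw [det_smul, Fintype.card_fin, det_mul, det_mul, det_conjTranspose, hAQ] at hd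
  rw [det_mul, det_mul, det_conjTranspose] at hVd
  have hFd : F.det = -((x ^ 2 + y ^ 2 : ℝ) : ℂ) := by
    rw [hF, det_fin_two_of]; push_cast; ring
  rw [hFd] at hVd
  rw [det_fin_two_of] at hd
  have hQ' : Q.det * star Q.det ≠ 0 := mul_ne_zero hQ (by simpa using hQ)
  apply mul_left_cancel₀ hQ'
  set D := (p₀ * (V * !![1, 0; 0, -1] * Vᴴ) * p₀ᴴ +
        p₁ * (V * !![1, 0; 0, -1] * Vᴴ) * p₁ᴴ + p₂ * (V * !![1, 0; 0, -1] * Vᴴ) * p₂ᴴ +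
        p₃ * (V * !![1, 0; 0, -1] * Vᴴ) * p₃ᴴ).det
  push_cast at hd hVd ⊢
  linear_combination -hd - D * hVd

/-- The `4 × 4` Sylvester-Hadamard sign matrix. -/
def hadamardSign (i k : Fin 2 × Fin 2) : ℤ := (-1) ^ ((i.1 : ℕ) * k.1 + (i.2 : ℕ) * k.2)

lemma hadamardSign_sq (i k : Fin 2 × Fin 2) : hadamardSign i k ^ 2 = 1 := by
  revert i k; decide

lemma sum_hadamardSign_mul (i j : Fin 2 × Fin 2) :
    ∑ k, hadamardSign i k * hadamardSign j k = if i = j then 4 else 0 := by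
  revert i j; decide

/-- The unitary obtained from half a Hadamard matrix by rescaling its columns by phases. -/
def phasedHadamard (ε : Fin 2 × Fin 2 → ℂ) : Matrix (Fin 2 × Fin 2) (Fin 2 × Fin 2) ℂ :=
  Matrix.of fun i k => (hadamardSign i k : ℂ) / 2 * ε k

lemma phasedHadamard_apply (ε : Fin 2 × Fin 2 → ℂ) (i k : Fin 2 × Fin 2) :
    phasedHadamard ε i k = (hadamardSign i k : ℂ) / 2 * ε k := rfl

lemma phasedHadamard_mem_unitaryGroup (ε : Fin 2 × Fin 2 → ℂ) (hε : ∀ k, ε k * star (ε k) = 1) :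
    phasedHadamard ε ∈ Matrix.unitaryGroup (Fin 2 × Fin 2) ℂ := by
  rw [Matrix.mem_unitaryGroup_iff]
  ext i j
  rw [Matrix.mul_apply, Matrix.one_apply]
  have h := congrArg (fun t : ℤ => (t : ℂ)) (sum_hadamardSign_mul i j)
  push_cast at h
  have : ∀ k, phasedHadamard ε i k * star (phasedHadamard ε) k j =
      (1 / 4) * ((hadamardSign i k : ℂ) * hadamardSign j k) := by
    intro k
    have hk := hε k
    rw [Matrix.star_apply, phasedHadamard_apply, phasedHadamard_apply]
    simp at hk ⊢
    linear_combination (hadamardSign i k * hadamardSign j k / 4 : ℂ) * hk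
  simp_rw [this, ← Finset.mul_sum, h]
  split_ifs <;> norm_num

open Matrix in
/-- The determinant of a combination of four matrices orthogonal for the polarized determinant. -/
lemma det_sum_smul_of_orthogonal (p : Fin 2 × Fin 2 → Matrix (Fin 2) (Fin 2) ℂ)
    (hp : ∀ k l, k ≠ l → ((p k).adjugate * p l).trace = 0) (c : Fin 2 × Fin 2 → ℂ) :
    (∑ k, c k • p k).det = ∑ k, c k ^ 2 * (p k).det := by
  have h := fun k l hkl => hp k l hkl
  simp only [adjugate_fin_two, trace_fin_two, mul_apply, Fin.sum_univ_two, of_apply,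
    cons_val', cons_val_zero, cons_val_one, cons_val_fin_one] at h
  have h1 := h (0, 0) (0, 1) (by decide)
  have h2 := h (0, 0) (1, 0) (by decide)
  have h3 := h (0, 0) (1, 1) (by decide)
  have h4 := h (0, 1) (1, 0) (by decide)
  have h5 := h (0, 1) (1, 1) (by decide)
  have h6 := h (1, 0) (1, 1) (by decide)
  simp only [Fintype.sum_prod_type, Fin.sum_univ_two, det_fin_two, Matrix.add_apply,
    Matrix.smul_apply,
    smul_eq_mul]
  linear_combination c (0, 0) * c (0, 1) * h1 + c (0, 0) * c (1, 0) * h2 +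
    c (0, 0) * c (1, 1) * h3 + c (0, 1) * c (1, 0) * h4 + c (0, 1) * c (1, 1) * h5 +
    c (1, 0) * c (1, 1) * h6

open Matrix in
lemma sum_norm_det_phasedHadamard (p : Fin 2 × Fin 2 → Matrix (Fin 2) (Fin 2) ℂ)
    (hp : ∀ k l, k ≠ l → ((p k).adjugate * p l).trace = 0) (ε : Fin 2 × Fin 2 → ℂ) :
    ∑ i, 2 * ‖(∑ k, phasedHadamard ε i k • p k).det‖ = 2 * ‖∑ k, ε k ^ 2 * (p k).det‖ := by
  have : ∀ i, (∑ k, phasedHadamard ε i k • p k).det = (1 / 4) * ∑ k, ε k ^ 2 * (p k).det := by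
    intro i
    rw [det_sum_smul_of_orthogonal p hp, Finset.mul_sum]
    refine Finset.sum_congr rfl fun k _ => ?_
    have h := congrArg (fun t : ℤ => (t : ℂ)) (hadamardSign_sq i k)
    push_cast at h
    rw [phasedHadamard_apply]
    linear_combination (ε k ^ 2 * (p k).det / 4) * h
  simp_rw [this, norm_mul]
  simp
  ring

open Matrix in
/-- The two-qubit estimate for ensembles orthogonal for the polarized determinant. -/
lemma exists_mixing_of_orthogonal (p : Fin 2 × Fin 2 → Matrix (Fin 2) (Fin 2) ℂ)
    (r : Fin 2 × Fin 2 → ℝ) (hr : ∀ k, 0 < r k) (hd : ∀ k, (p k).det = (r k : ℂ) ^ 2)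
    (hp : ∀ k l, k ≠ l → ((p k).adjugate * p l).trace = 0) :
    ∃ W ∈ unitaryGroup (Fin 2 × Fin 2) ℂ, ∃ V ∈ unitaryGroup (Fin 2) ℂ,
      (∑ i, 2 * ‖(∑ k, W i k • p k).det‖) ^ 2 +
        4 * (∑ k, p k * (V * !![1, 0; 0, -1] * Vᴴ) * (p k)ᴴ).det.re ≤ 0 := by
  obtain ⟨V, hV, x, y, hxy, hdet⟩ := exists_unitary_det_eq (p (0, 0)) (p (0, 1)) (p (1, 0))
    (p (1, 1)) _ _ _ _ (hr _) (hr _) (hr _) (hr _) (hd _) (hd _) (hd _) (hd _)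
    (hp _ _ (by decide)) (hp _ _ (by decide)) (hp _ _ (by decide)) (hp _ _ (by decide))
    (hp _ _ (by decide)) (hp _ _ (by decide))
  set s₁ := r (0, 0) ^ 2 + r (0, 1) ^ 2 - r (1, 0) ^ 2 - r (1, 1) ^ 2 with hs₁
  set s₂ := r (0, 0) ^ 2 - r (0, 1) ^ 2 - r (1, 0) ^ 2 + r (1, 1) ^ 2 with hs₂
  have hsum : (∑ k, p k * (V * !![1, 0; 0, -1] * Vᴴ) * (p k)ᴴ) =
      p (0, 0) * (V * !![1, 0; 0, -1] * Vᴴ) * (p (0, 0))ᴴ +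
        p (0, 1) * (V * !![1, 0; 0, -1] * Vᴴ) * (p (0, 1))ᴴ +
        p (1, 0) * (V * !![1, 0; 0, -1] * Vᴴ) * (p (1, 0))ᴴ +
        p (1, 1) * (V * !![1, 0; 0, -1] * Vᴴ) * (p (1, 1))ᴴ := by
    simp only [Fintype.sum_prod_type, Fin.sum_univ_two, add_assoc]
  rw [← hsum] at hdet
  set D := (∑ k, p k * (V * !![1, 0; 0, -1] * Vᴴ) * (p k)ᴴ).det
  have hre := congrArg Complex.re hdet
  rw [Complex.re_ofReal_mul, Complex.neg_re, Complex.ofReal_re] at hre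
  have key : ∀ c : ℝ, c ^ 2 ≤ s₁ ^ 2 → c ^ 2 ≤ s₂ ^ 2 → (2 * |c|) ^ 2 + 4 * D.re ≤ 0 := by
    intro c h1 h2
    have h3 : (x ^ 2 + y ^ 2) * (c ^ 2 + D.re) ≤ 0 := by
      nlinarith [mul_le_mul_of_nonneg_left h1 (sq_nonneg x),
        mul_le_mul_of_nonneg_left h2 (sq_nonneg y)]
    have h4 : c ^ 2 + D.re ≤ 0 := by
      by_contra! h
      exact absurd h3 (not_le.2 (mul_pos hxy h))
    rw [mul_pow, sq_abs]; linarith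
  have fin : ∀ (c : ℝ) (ε : Fin 2 × Fin 2 → ℂ), (∀ k, ε k * star (ε k) = 1) →
      (∑ k, ε k ^ 2 * (p k).det = (c : ℂ)) → c ^ 2 ≤ s₁ ^ 2 → c ^ 2 ≤ s₂ ^ 2 →
      ∃ W ∈ unitaryGroup (Fin 2 × Fin 2) ℂ, ∃ V ∈ unitaryGroup (Fin 2) ℂ,
      (∑ i, 2 * ‖(∑ k, W i k • p k).det‖) ^ 2 +
        4 * (∑ k, p k * (V * !![1, 0; 0, -1] * Vᴴ) * (p k)ᴴ).det.re ≤ 0 := by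
    intro c ε hε hc h1 h2
    refine ⟨phasedHadamard ε, phasedHadamard_mem_unitaryGroup ε hε, V, hV, ?_⟩
    rw [sum_norm_det_phasedHadamard p hp, hc, Complex.norm_real, Real.norm_eq_abs]
    exact key c h1 h2
  rcases le_total (s₁ ^ 2) (s₂ ^ 2) with h | h
  · refine fin s₁ (fun k => if k.1 = 0 then 1 else Complex.I) ?_ ?_ le_rfl h
    · intro k; split_ifs <;> simp
    · simp [Fintype.sum_prod_type, Fin.sum_univ_two, hd, hs₁]; ring
  · refine fin s₂ (fun k => if k.1 = k.2 then 1 else Complex.I) ?_ ?_ h le_rfl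
    · intro k; split_ifs <;> simp
    · simp [Fintype.sum_prod_type, Fin.sum_univ_two, hd, hs₂]; ring

lemma sum_unitary_mixing {κ : Type*} [Fintype κ] [DecidableEq κ] {M : Type*} [AddCommMonoid M]
    [Module ℂ M] {U : Matrix κ κ ℂ} (hU : U ∈ Matrix.unitaryGroup κ ℂ) (B : κ → κ → M) :
    ∑ j, ∑ k, ∑ l, (U j k * star (U j l)) • B k l = ∑ k, B k k := by
  have h : ∀ k l, ∑ j, U j k * star (U j l) = if k = l then 1 else 0 := by
    intro k l
    have := congrFun (congrFun (Matrix.mem_unitaryGroup_iff'.1 hU) l) k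
    rw [Matrix.mul_apply, Matrix.one_apply] at this
    simp only [Matrix.star_apply] at this
    simp_rw [mul_comm (U _ k), this, eq_comm]
  rw [Finset.sum_comm]
  refine Finset.sum_congr rfl fun k _ => ?_
  rw [Finset.sum_comm]
  simp_rw [← Finset.sum_smul, h]
  simp

/-- A column of a matrix with rows indexed by `Fin 2 × Fin 2`, reshaped as a `2 × 2` matrix. -/
def colMat {κ : Type*} (Ψ : Matrix (Fin 2 × Fin 2) κ ℂ) (k : κ) : Matrix (Fin 2) (Fin 2) ℂ :=
  Matrix.of fun i j => Ψ (i, j) k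

@[simp] lemma colMat_apply {κ : Type*} (Ψ : Matrix (Fin 2 × Fin 2) κ ℂ) (k : κ) (i j : Fin 2) :
    colMat Ψ k i j = Ψ (i, j) k := rfl

/-- The Gram matrix of the polarized determinant on the standard basis. -/
def spinFlip : Matrix (Fin 2 × Fin 2) (Fin 2 × Fin 2) ℂ :=
  Matrix.of fun x y => if x.1 ≠ y.1 ∧ x.2 ≠ y.2 then (if x.1 = x.2 then 1 else -1) else 0

lemma spinFlip_apply (x y : Fin 2 × Fin 2) : spinFlip x y =
    if x.1 ≠ y.1 ∧ x.2 ≠ y.2 then (if x.1 = x.2 then 1 else -1) else 0 := rfl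

open Matrix in
lemma spinFlip_transpose : spinFlipᵀ = spinFlip := by
  ext x y
  rw [transpose_apply, spinFlip_apply, spinFlip_apply]
  revert x y
  simp only [Prod.forall, Fin.forall_fin_two]
  simp

lemma spinFlip_mul_self : spinFlip * spinFlip = 1 := by
  ext ⟨a, b⟩ ⟨c, d⟩
  fin_cases a <;> fin_cases b <;> fin_cases c <;> fin_cases d <;>
    simp [Matrix.mul_apply, Fintype.sum_prod_type, spinFlip_apply]

open Matrix in
lemma trace_adjugate_colMat {κ : Type*} (Ψ : Matrix (Fin 2 × Fin 2) κ ℂ) (k l : κ) :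
    ((colMat Ψ k).adjugate * colMat Ψ l).trace = (Ψᵀ * spinFlip * Ψ) k l := by
  simp only [adjugate_fin_two, trace_fin_two, mul_apply, Fin.sum_univ_two, of_apply,
    cons_val', cons_val_zero, cons_val_one, cons_val_fin_one, colMat_apply, transpose_apply,
    Fintype.sum_prod_type, spinFlip_apply]
  simp
  ring

open Matrix in
lemma colMat_mul_transpose {κ : Type*} [Fintype κ] (Ψ : Matrix (Fin 2 × Fin 2) κ ℂ)
    (U : Matrix κ κ ℂ) (i : κ) : colMat (Ψ * Uᵀ) i = ∑ k, U i k • colMat Ψ k := by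
  ext a b
  simp [Matrix.sum_apply, mul_apply, mul_comm]

open Matrix in
lemma sum_conj_of_unitary_mixing {κ : Type*} [Fintype κ] [DecidableEq κ] {U : Matrix κ κ ℂ}
    (hU : U ∈ unitaryGroup κ ℂ) (g : κ → Matrix (Fin 2) (Fin 2) ℂ) (M : Matrix (Fin 2) (Fin 2) ℂ) :
    ∑ j, (∑ k, U j k • g k) * M * (∑ k, U j k • g k)ᴴ = ∑ k, g k * M * (g k)ᴴ := by
  rw [← sum_unitary_mixing hU fun k l => g k * M * (g l)ᴴ]
  refine Finset.sum_congr rfl fun j _ => ?_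
  rw [conjTranspose_sum, Finset.sum_mul, Finset.sum_mul]
  refine Finset.sum_congr rfl fun k _ => ?_
  rw [Finset.mul_sum]
  refine Finset.sum_congr rfl fun l _ => ?_
  rw [conjTranspose_smul, Matrix.smul_mul, Matrix.smul_mul, Matrix.mul_smul, smul_smul]

open Matrix in
/-- The two-qubit functional comparing a mixed ensemble with a rotated splitting. -/
def mixFun (Ψ : Matrix (Fin 2 × Fin 2) (Fin 2 × Fin 2) ℂ)
    (U : Matrix (Fin 2 × Fin 2) (Fin 2 × Fin 2) ℂ) (V : Matrix (Fin 2) (Fin 2) ℂ) : ℝ :=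
  (∑ i, 2 * ‖(colMat (Ψ * Uᵀ) i).det‖) ^ 2 +
    4 * (∑ k, colMat Ψ k * (V * !![1, 0; 0, -1] * Vᴴ) * (colMat Ψ k)ᴴ).det.re

open Matrix in
lemma exists_mixFun_nonpos_of_det_ne_zero (Ψ : Matrix (Fin 2 × Fin 2) (Fin 2 × Fin 2) ℂ)
    (hΨ : Ψ.det ≠ 0) : ∃ U ∈ unitaryGroup (Fin 2 × Fin 2) ℂ, ∃ V ∈ unitaryGroup (Fin 2) ℂ,
      mixFun Ψ U V ≤ 0 := by
  obtain ⟨U, hU, μ, hμ, hdiag⟩ := exists_takagi (Ψᵀ * spinFlip * Ψ) (by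
    rw [transpose_mul, transpose_mul, transpose_transpose, spinFlip_transpose, Matrix.mul_assoc])
  have hτ : (Ψ * Uᵀ)ᵀ * spinFlip * (Ψ * Uᵀ) = diagonal fun i => (μ i : ℂ) := by
    rw [← hdiag, transpose_mul, transpose_transpose]; simp only [Matrix.mul_assoc]
  have hμ0 : ∀ i, μ i ≠ 0 := by
    have h := congrArg det hτ
    rw [det_mul, det_mul, det_transpose, det_mul, det_transpose, det_diagonal] at h
    have hs : spinFlip.det ≠ 0 := by
      intro h0
      have := congrArg det spinFlip_mul_self
      rw [det_mul, h0] at this; simp at this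
    have hUd : U.det ≠ 0 := by
      intro h0
      have := congrArg det (mem_unitaryGroup_iff.1 hU)
      rw [det_mul, h0] at this; simp at this
    have hne : ∏ i, (μ i : ℂ) ≠ 0 := by
      rw [← h]; exact mul_ne_zero (mul_ne_zero (mul_ne_zero hΨ hUd) hs) (mul_ne_zero hΨ hUd)
    intro i h0
    exact (Finset.prod_ne_zero_iff.1 hne i (Finset.mem_univ i)) (by simp [h0])
  have htr : ∀ k l, ((colMat (Ψ * Uᵀ) k).adjugate * colMat (Ψ * Uᵀ) l).trace =
      if k = l then (μ k : ℂ) else 0 := by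
    intro k l; rw [trace_adjugate_colMat, hτ, diagonal_apply]
  have hpos : ∀ k, 0 < μ k := fun k => lt_of_le_of_ne (hμ k) (hμ0 k).symm
  obtain ⟨W, hW, V, hV, h⟩ := exists_mixing_of_orthogonal (colMat (Ψ * Uᵀ))
    (fun k => Real.sqrt (μ k / 2)) (fun k => Real.sqrt_pos.2 (half_pos (hpos k)))
    (fun k => by
      have h := htr k k
      rw [adjugate_mul, if_pos rfl] at h
      rw [← Complex.ofReal_pow, Real.sq_sqrt (half_pos (hpos k)).le]
      simp at h
      push_cast; linear_combination h / 2)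
    (fun k l hkl => by rw [htr, if_neg hkl])
  refine ⟨W * U, mul_mem hW hU, V, hV, ?_⟩
  simp_rw [← colMat_mul_transpose, colMat_mul_transpose Ψ U,
    sum_conj_of_unitary_mixing hU (colMat Ψ)] at h
  rw [mixFun, transpose_mul, ← Matrix.mul_assoc]
  exact h

open Matrix in
lemma isCompact_unitaryGroup (κ : Type*) [Fintype κ] [DecidableEq κ] :
    IsCompact (unitaryGroup κ ℂ : Set (Matrix κ κ ℂ)) := by
  have hc : IsCompact (Set.pi Set.univ fun _ : κ => Set.pi Set.univ fun _ : κ =>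
      Metric.closedBall (0 : ℂ) 1) :=
    isCompact_univ_pi fun _ => isCompact_univ_pi fun _ => isCompact_closedBall _ _
  refine IsCompact.of_isClosed_subset (X := Matrix κ κ ℂ) hc ?_ ?_
  · have : (unitaryGroup κ ℂ : Set (Matrix κ κ ℂ)) = {U | U * star U = 1} := by
      ext U; exact mem_unitaryGroup_iff
    rw [this]
    exact isClosed_eq (by fun_prop) continuous_const
  · intro U hU i _ j _
    simpa using entry_norm_bound_of_unitary hU i j

open Matrix in
lemma continuous_mixFun : Continuous fun q : Matrix (Fin 2 × Fin 2) (Fin 2 × Fin 2) ℂ ×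
    (Matrix (Fin 2 × Fin 2) (Fin 2 × Fin 2) ℂ × Matrix (Fin 2) (Fin 2) ℂ) =>
      mixFun q.1 q.2.1 q.2.2 := by
  have hc : ∀ k : Fin 2 × Fin 2, Continuous fun Ψ : Matrix (Fin 2 × Fin 2) (Fin 2 × Fin 2) ℂ =>
      colMat Ψ k := fun k => continuous_matrix fun i j => by
    simp only [colMat_apply]; fun_prop
  unfold mixFun
  have h1 : ∀ k : Fin 2 × Fin 2, Continuous fun q : Matrix (Fin 2 × Fin 2) (Fin 2 × Fin 2) ℂ ×
    (Matrix (Fin 2 × Fin 2) (Fin 2 × Fin 2) ℂ × Matrix (Fin 2) (Fin 2) ℂ) =>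
      colMat (q.1 * q.2.1ᵀ) k := fun k => (hc k).comp (by fun_prop)
  have h2 : ∀ k : Fin 2 × Fin 2, Continuous fun q : Matrix (Fin 2 × Fin 2) (Fin 2 × Fin 2) ℂ ×
    (Matrix (Fin 2 × Fin 2) (Fin 2 × Fin 2) ℂ × Matrix (Fin 2) (Fin 2) ℂ) =>
      colMat q.1 k := fun k => (hc k).comp (by fun_prop)
  fun_prop

lemma isClosed_setOf_exists_mem_nonpos {X Y : Type*} [TopologicalSpace X] [TopologicalSpace Y]
    {K : Set Y} (hK : IsCompact K) {f : X × Y → ℝ} (hf : Continuous f) :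
    IsClosed {x | ∃ y ∈ K, f (x, y) ≤ 0} := by
  have : CompactSpace K := isCompact_iff_compactSpace.1 hK
  have hS : IsClosed {q : X × K | f (q.1, q.2) ≤ 0} :=
    isClosed_le (hf.comp (by fun_prop)) continuous_const
  convert isClosedMap_fst_of_compactSpace _ hS using 1
  ext x
  simp

open Matrix in
/-- The two-qubit estimate: some unitary mixing of the ensemble `Ψ` has squared average
concurrence bounded by a determinant coming from a unitary splitting of the second qubit. -/
lemma exists_mixFun_nonpos (Ψ : Matrix (Fin 2 × Fin 2) (Fin 2 × Fin 2) ℂ) :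
    ∃ U ∈ unitaryGroup (Fin 2 × Fin 2) ℂ, ∃ V ∈ unitaryGroup (Fin 2) ℂ, mixFun Ψ U V ≤ 0 := by
  set S : Set (Matrix (Fin 2 × Fin 2) (Fin 2 × Fin 2) ℂ) :=
    {Ψ | ∃ q ∈ (unitaryGroup (Fin 2 × Fin 2) ℂ : Set (Matrix (Fin 2 × Fin 2) (Fin 2 × Fin 2) ℂ)) ×ˢ
      (unitaryGroup (Fin 2) ℂ : Set (Matrix (Fin 2) (Fin 2) ℂ)), mixFun Ψ q.1 q.2 ≤ 0} with hS
  have hcl : IsClosed S := isClosed_setOf_exists_mem_nonpos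
    ((isCompact_unitaryGroup _).prod (isCompact_unitaryGroup _)) continuous_mixFun
  suffices Ψ ∈ closure S by
    rw [hcl.closure_eq] at this
    obtain ⟨⟨U, V⟩, hUV, hq⟩ := this
    exact ⟨U, hUV.1, V, hUV.2, hq⟩
  have hroots : ∀ᶠ t : ℂ in nhdsWithin 0 {0}ᶜ, (Ψ + t • 1).det ≠ 0 := by
    have hfin : {t : ℂ | (-Ψ).charpoly.IsRoot t}.Finite :=
      Polynomial.finite_setOfPred_isRoot (charpoly_monic _).ne_zero
    have h2 : ({t : ℂ | (-Ψ).charpoly.IsRoot t} \ {0})ᶜ ∈ nhds (0 : ℂ) :=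
      (hfin.subset Set.sdiff_subset).isClosed.isOpen_compl.mem_nhds (by simp)
    filter_upwards [nhdsWithin_le_nhds h2, self_mem_nhdsWithin] with t ht ht0 hdet
    refine ht ⟨?_, ht0⟩
    rw [Set.mem_ofPred_eq, Polynomial.IsRoot, eval_charpoly, ← hdet]
    congr 1
    rw [sub_neg_eq_add, add_comm]; congr 1
    ext i j; simp [scalar_apply, diagonal_apply, one_apply]
  have htend : Filter.Tendsto (fun t : ℂ => Ψ + t • (1 : Matrix (Fin 2 × Fin 2) (Fin 2 × Fin 2) ℂ))
      (nhdsWithin 0 {0}ᶜ) (nhds Ψ) := by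
    have : Continuous fun t : ℂ => Ψ + t • (1 : Matrix (Fin 2 × Fin 2) (Fin 2 × Fin 2) ℂ) := by
      fun_prop
    simpa using (this.tendsto 0).mono_left nhdsWithin_le_nhds
  refine mem_closure_of_tendsto htend (hroots.mono fun t ht => ?_)
  obtain ⟨U, hU, V, hV, h⟩ := exists_mixFun_nonpos_of_det_ne_zero _ ht
  exact ⟨(U, V), ⟨hU, hV⟩, h⟩

/-- The squared minors of a bipartite pure state sum to its (unnormalized) linear entropy. -/
lemma sum_norm_sq_minor {S T : Type*} [Fintype S] [Fintype T] (ψ : S × T → ℂ) :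
    ∑ x : S × T, ∑ y : S × T, ‖ψ x * ψ y - ψ (y.1, x.2) * ψ (x.1, y.2)‖ ^ 2 =
      2 * ((∑ x, ‖ψ x‖ ^ 2) ^ 2 - trSq (ptraceRight (pureDM ψ))) := by
  have h1 : ∑ x : S × T, ∑ y : S × T, ‖ψ x * ψ y‖ ^ 2 = (∑ x, ‖ψ x‖ ^ 2) ^ 2 := by
    simp_rw [norm_mul, mul_pow, ← Finset.mul_sum, ← Finset.sum_mul, pow_two]
  have h2 : ∑ x : S × T, ∑ y : S × T, ‖ψ (y.1, x.2) * ψ (x.1, y.2)‖ ^ 2 =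
      (∑ x, ‖ψ x‖ ^ 2) ^ 2 := by
    rw [← h1]
    let e : (S × T) × (S × T) ≃ (S × T) × (S × T) :=
      ⟨fun q => ((q.2.1, q.1.2), (q.1.1, q.2.2)), fun q => ((q.2.1, q.1.2), (q.1.1, q.2.2)),
        fun _ => rfl, fun _ => rfl⟩
    rw [← Fintype.sum_prod_type', ← Fintype.sum_prod_type']
    exact e.sum_comp fun q => ‖ψ q.1 * ψ q.2‖ ^ 2
  have h3 : ∑ x : S × T, ∑ y : S × T,
      ψ x * ψ y * star (ψ (y.1, x.2) * ψ (x.1, y.2)) =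
        (ptraceRight (pureDM ψ) * ptraceRight (pureDM ψ)).trace := by
    simp only [Matrix.trace, Matrix.diag, Matrix.mul_apply, ptraceRight, pureDM,
      Finset.sum_mul_sum, Fintype.sum_prod_type]
    refine Finset.sum_congr rfl fun s _ => ?_
    rw [Finset.sum_comm]
    refine Finset.sum_congr rfl fun s' _ => Finset.sum_congr rfl fun t _ =>
      Finset.sum_congr rfl fun t' _ => ?_
    simp
    ring
  have h4 : ∀ z w : ℂ, ‖z - w‖ ^ 2 = ‖z‖ ^ 2 + ‖w‖ ^ 2 - 2 * (z * star w).re := by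
    intro z w
    rw [← Complex.normSq_eq_norm_sq, Complex.normSq_sub, Complex.normSq_eq_norm_sq,
      Complex.normSq_eq_norm_sq]
    rfl
  simp_rw [h4, Finset.sum_sub_distrib, Finset.sum_add_distrib, h1, h2, ← Finset.mul_sum,
    ← Complex.re_sum, h3, trSq]
  ring

/-- The values `∑ 2 |det φᵢ|` over finite unnormalized ensembles of a two-qubit operator. -/
def ensValues (ρ : Matrix (Fin 2 × Fin 2) (Fin 2 × Fin 2) ℂ) : Set ℝ :=
  {r | ∃ (n : ℕ) (Ψ : Matrix (Fin 2 × Fin 2) (Fin n) ℂ), ρ = Ψ * Ψ.conjTranspose ∧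
    r = ∑ i, 2 * ‖(colMat Ψ i).det‖}

open Matrix in
lemma mem_ensValues {F : Type*} [Fintype F] (Ψ : Matrix (Fin 2 × Fin 2) F ℂ) :
    ∑ i, 2 * ‖(colMat Ψ i).det‖ ∈ ensValues (Ψ * Ψᴴ) := by
  let e := Fintype.equivFin F
  refine ⟨_, Ψ.submatrix id e.symm, ?_, ?_⟩
  · rw [conjTranspose_submatrix, submatrix_mul_equiv, submatrix_id_id]
  · exact (e.symm.sum_comp fun i => 2 * ‖(colMat Ψ i).det‖).symm

open Matrix in
lemma add_mem_ensValues {ρ σ : Matrix (Fin 2 × Fin 2) (Fin 2 × Fin 2) ℂ} {r s : ℝ}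
    (hr : r ∈ ensValues ρ) (hs : s ∈ ensValues σ) : r + s ∈ ensValues (ρ + σ) := by
  obtain ⟨n, Ψ, rfl, rfl⟩ := hr
  obtain ⟨m, Φ, rfl, rfl⟩ := hs
  have h := mem_ensValues (fromCols Ψ Φ)
  rw [conjTranspose_fromCols_eq_fromRows_conjTranspose, fromCols_mul_fromRows,
    Fintype.sum_sum_type] at h
  exact h

lemma nonneg_of_mem_ensValues {ρ : Matrix (Fin 2 × Fin 2) (Fin 2 × Fin 2) ℂ} {r : ℝ}
    (hr : r ∈ ensValues ρ) : 0 ≤ r := by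
  obtain ⟨n, Ψ, rfl, rfl⟩ := hr
  positivity

lemma pureConc_eq_norm_det (φ : Fin 2 × Fin 2 → ℂ) (hφ : ∑ x, ‖φ x‖ ^ 2 = 1) :
    pureConc φ = 2 * ‖φ (0, 0) * φ (1, 1) - φ (0, 1) * φ (1, 0)‖ := by
  have h := sum_norm_sq_minor φ
  rw [hφ] at h
  have h2 : 2 * (1 - trSq (ptraceRight (pureDM φ))) =
      (2 * ‖φ (0, 0) * φ (1, 1) - φ (0, 1) * φ (1, 0)‖) ^ 2 := by
    rw [one_pow] at h
    rw [← h]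
    simp only [Fintype.sum_prod_type, Fin.sum_univ_two, sub_self, norm_zero]
    have n1 : ‖φ (0, 1) * φ (1, 0) - φ (1, 1) * φ (0, 0)‖ =
        ‖φ (0, 0) * φ (1, 1) - φ (0, 1) * φ (1, 0)‖ := by rw [norm_sub_rev]; ring_nf
    have n2 : ‖φ (1, 0) * φ (0, 1) - φ (0, 0) * φ (1, 1)‖ =
        ‖φ (0, 0) * φ (1, 1) - φ (0, 1) * φ (1, 0)‖ := by rw [norm_sub_rev]; ring_nf
    have n3 : ‖φ (1, 1) * φ (0, 0) - φ (0, 1) * φ (1, 0)‖ =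
        ‖φ (0, 0) * φ (1, 1) - φ (0, 1) * φ (1, 0)‖ := by ring_nf
    have n4 : ‖φ (0, 0) * φ (1, 1) - φ (1, 0) * φ (0, 1)‖ =
        ‖φ (0, 0) * φ (1, 1) - φ (0, 1) * φ (1, 0)‖ := by ring_nf
    rw [n1, n2, n3, n4, mul_comm (φ (1, 0)) (φ (0, 0)), mul_comm (φ (1, 1)) (φ (0, 1)), sub_self,
      sub_self, norm_zero]
    ring
  rw [pureConc, h2, Real.sqrt_sq (by positivity)]

lemma nonneg_of_mem_concSet {S T : Type*} [Fintype S] [Fintype T] {ρ : Matrix (S × T) (S × T) ℂ}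
    {c : ℝ} (hc : c ∈ concSet ρ) : 0 ≤ c := by
  obtain ⟨n, p, φ, hp, -, -, -, rfl⟩ := hc
  exact Finset.sum_nonneg fun i _ => mul_nonneg (hp i) (Real.sqrt_nonneg _)

lemma le_one_of_mem_concSet {ρ : Matrix (Fin 2 × Fin 2) (Fin 2 × Fin 2) ℂ}
    {c : ℝ} (hc : c ∈ concSet ρ) : c ≤ 1 := by
  obtain ⟨n, p, φ, hp, hp1, hφ, -, rfl⟩ := hc
  rw [← hp1]
  refine Finset.sum_le_sum fun i _ => mul_le_of_le_one_right (hp i) ?_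
  rw [pureConc_eq_norm_det _ (hφ i)]
  have h := hφ i
  simp only [Fintype.sum_prod_type, Fin.sum_univ_two] at h
  have h2 := norm_sub_le (φ i (0, 0) * φ i (1, 1)) (φ i (0, 1) * φ i (1, 0))
  rw [norm_mul, norm_mul] at h2
  nlinarith [sq_nonneg (‖φ i (0, 0)‖ - ‖φ i (1, 1)‖), sq_nonneg (‖φ i (0, 1)‖ - ‖φ i (1, 0)‖)]

open Matrix in
lemma mem_concSet_of_mem_ensValues {ρ : Matrix (Fin 2 × Fin 2) (Fin 2 × Fin 2) ℂ}
    (hρ : ρ.trace = 1) {r : ℝ} (hr : r ∈ ensValues ρ) : r ∈ concSet ρ := by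
  obtain ⟨n, Ψ, rfl, rfl⟩ := hr
  set p : Fin n → ℝ := fun i => ∑ x, ‖Ψ x i‖ ^ 2 with hp
  have hp0 : ∀ i, 0 ≤ p i := fun i => by positivity
  have hz : ∀ i, p i = 0 → ∀ x, Ψ x i = 0 := by
    intro i hi x
    have := (Finset.sum_eq_zero_iff_of_nonneg (fun x _ => by positivity)).1 hi x (Finset.mem_univ x)
    simpa using this
  set φ : Fin n → Fin 2 × Fin 2 → ℂ := fun i x =>
    if p i = 0 then (if x = (0, 0) then 1 else 0) else ((Real.sqrt (p i) : ℂ))⁻¹ * Ψ x i with hφ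
  have hscale : ∀ i x, (Real.sqrt (p i) : ℂ) * φ i x = Ψ x i := by
    intro i x
    by_cases h : p i = 0
    · simp [h, hz i h x]
    · have : (Real.sqrt (p i) : ℂ) ≠ 0 := by
        exact_mod_cast (Real.sqrt_pos.2 (lt_of_le_of_ne (hp0 i) (Ne.symm h))).ne'
      simp only [hφ, if_neg h]
      rw [mul_inv_cancel_left₀ this]
  have hsq : ∀ i, (Real.sqrt (p i) : ℂ) * Real.sqrt (p i) = p i := by
    intro i; rw [← Complex.ofReal_mul, Real.mul_self_sqrt (hp0 i)]
  have hφ1 : ∀ i, ∑ x, ‖φ i x‖ ^ 2 = 1 := by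
    intro i
    by_cases h : p i = 0
    · simp [hφ, h, apply_ite]
    · have h1 : p i * ∑ x, ‖φ i x‖ ^ 2 = p i := by
        conv_rhs => rw [hp]
        rw [Finset.mul_sum]
        refine Finset.sum_congr rfl fun x _ => ?_
        rw [← hscale i x, norm_mul, mul_pow, Complex.norm_real, Real.norm_eq_abs, sq_abs,
          Real.sq_sqrt (hp0 i)]
      exact mul_left_cancel₀ h (by rw [h1, mul_one])
  refine ⟨n, p, φ, hp0, ?_, hφ1, ?_, ?_⟩
  · have h := congrArg Complex.re hρ
    simp only [trace, diag, mul_apply, conjTranspose_apply, Complex.re_sum, Complex.one_re] at h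
    rw [← h, Finset.sum_comm]
    refine Finset.sum_congr rfl fun x _ => Finset.sum_congr rfl fun i _ => ?_
    rw [Complex.star_def, Complex.mul_conj, Complex.ofReal_re, Complex.normSq_eq_norm_sq]
  · ext x y
    rw [Matrix.sum_apply, mul_apply]
    refine Finset.sum_congr rfl fun i _ => ?_
    rw [conjTranspose_apply, ← hscale i x, ← hscale i y, Matrix.smul_apply, pureDM, ← hsq i]
    simp
    ring
  · refine Finset.sum_congr rfl fun i _ => ?_
    rw [pureConc_eq_norm_det _ (hφ1 i), det_fin_two]
    simp only [colMat_apply, ← hscale]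
    have : (Real.sqrt (p i) : ℂ) * φ i (0, 0) * ((Real.sqrt (p i) : ℂ) * φ i (1, 1)) -
        (Real.sqrt (p i) : ℂ) * φ i (0, 1) * ((Real.sqrt (p i) : ℂ) * φ i (1, 0)) =
        (p i : ℂ) * (φ i (0, 0) * φ i (1, 1) - φ i (0, 1) * φ i (1, 0)) := by
      rw [← hsq i]; ring
    rw [this, norm_mul, Complex.norm_real, Real.norm_of_nonneg (hp0 i)]
    ring

lemma conc_le_of_mem_ensValues {ρ : Matrix (Fin 2 × Fin 2) (Fin 2 × Fin 2) ℂ}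
    (hρ : ρ.trace = 1) {r : ℝ} (hr : r ∈ ensValues ρ) : conc ρ ≤ r :=
  csInf_le ⟨0, fun _ hc => nonneg_of_mem_concSet hc⟩ (mem_concSet_of_mem_ensValues hρ hr)

lemma le_concA_of_mem_ensValues {ρ : Matrix (Fin 2 × Fin 2) (Fin 2 × Fin 2) ℂ}
    (hρ : ρ.trace = 1) {r : ℝ} (hr : r ∈ ensValues ρ) : r ≤ concA ρ :=
  le_csSup ⟨1, fun _ hc => le_one_of_mem_concSet hc⟩ (mem_concSet_of_mem_ensValues hρ hr)

lemma conc_nonneg {S T : Type*} [Fintype S] [Fintype T] (ρ : Matrix (S × T) (S × T) ℂ) :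
    0 ≤ conc ρ :=
  Real.sInf_nonneg fun _ hc => nonneg_of_mem_concSet hc

open Matrix in
open scoped MatrixOrder ComplexOrder Matrix.Norms.L2Operator in
lemma exists_eq_mul_conjTranspose_square {κ F : Type*} [Fintype κ] [DecidableEq κ] [Fintype F]
    (Ψ : Matrix κ F ℂ) : ∃ B : Matrix κ κ ℂ, Ψ * Ψᴴ = B * Bᴴ :=
  (CStarAlgebra.nonneg_iff_eq_mul_star_self (a := Ψ * Ψᴴ)).1
    (posSemidef_self_mul_conjTranspose Ψ).nonneg

/-- The first-qubit operator of the `m`-th branch when the second qubit is split along `V`. -/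
def branchDM (V : Matrix (Fin 2) (Fin 2) ℂ) (m : Fin 2)
    (ρ : Matrix (Fin 2 × Fin 2) (Fin 2 × Fin 2) ℂ) : Matrix (Fin 2) (Fin 2) ℂ :=
  Matrix.of fun i j => ∑ b, ∑ b', V b m * star (V b' m) * ρ (i, b) (j, b')

lemma branchDM_apply (V : Matrix (Fin 2) (Fin 2) ℂ) (m : Fin 2)
    (ρ : Matrix (Fin 2 × Fin 2) (Fin 2 × Fin 2) ℂ) (i j : Fin 2) :
    branchDM V m ρ i j = ∑ b, ∑ b', V b m * star (V b' m) * ρ (i, b) (j, b') := rfl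

lemma branchDM_add (V : Matrix (Fin 2) (Fin 2) ℂ) (hV : V ∈ Matrix.unitaryGroup (Fin 2) ℂ)
    (ρ : Matrix (Fin 2 × Fin 2) (Fin 2 × Fin 2) ℂ) :
    branchDM V 0 ρ + branchDM V 1 ρ = ptraceRight ρ := by
  have h := fun b b' => congrFun (congrFun (Matrix.mem_unitaryGroup_iff.1 hV) b) b'
  simp only [Matrix.mul_apply, Fin.sum_univ_two, Matrix.star_apply, Matrix.one_apply] at h
  have h1 := h 0 0
  have h2 := h 0 1
  have h3 := h 1 0
  have h4 := h 1 1
  simp only [if_true, if_false, zero_ne_one, one_ne_zero] at h1 h2 h3 h4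
  ext i j
  simp only [Matrix.add_apply, branchDM_apply, Fin.sum_univ_two, ptraceRight]
  linear_combination ρ (i, 0) (j, 0) * h1 + ρ (i, 0) (j, 1) * h2 + ρ (i, 1) (j, 0) * h3 +
    ρ (i, 1) (j, 1) * h4

open Matrix in
lemma branchDM_sub {F : Type*} [Fintype F] (V : Matrix (Fin 2) (Fin 2) ℂ)
    (Ψ : Matrix (Fin 2 × Fin 2) F ℂ) :
    branchDM V 0 (Ψ * Ψᴴ) - branchDM V 1 (Ψ * Ψᴴ) =
      ∑ k, colMat Ψ k * (V * !![1, 0; 0, -1] * Vᴴ) * (colMat Ψ k)ᴴ := by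
  have hM : ∀ b b', (V * !![1, 0; 0, -1] * Vᴴ : Matrix (Fin 2) (Fin 2) ℂ) b b' =
      V b 0 * star (V b' 0) - V b 1 * star (V b' 1) := by
    intro b b'
    simp [mul_apply, Fin.sum_univ_two]
    ring
  ext i j
  simp only [Matrix.sub_apply, branchDM_apply, Matrix.sum_apply, mul_apply (N := (colMat Ψ _)ᴴ),
    mul_apply (M := colMat Ψ _), hM, mul_apply (M := Ψ), Finset.mul_sum, Fin.sum_univ_two,
    ← Finset.sum_add_distrib, ← Finset.sum_sub_distrib, colMat_apply, conjTranspose_apply]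
  refine Finset.sum_congr rfl fun k _ => ?_
  ring

open Matrix in
/-- Every two-qubit ensemble admits an average concurrence value which, together with a splitting
of the second qubit, is controlled by the first-qubit determinant. -/
lemma exists_ensValues_branchDM {F : Type*} [Fintype F] (Ψ : Matrix (Fin 2 × Fin 2) F ℂ) :
    ∃ α ∈ ensValues (Ψ * Ψᴴ), ∃ V ∈ unitaryGroup (Fin 2) ℂ,
      α ^ 2 + 8 * ((branchDM V 0 (Ψ * Ψᴴ)).det.re + (branchDM V 1 (Ψ * Ψᴴ)).det.re) ≤
        4 * (ptraceRight (Ψ * Ψᴴ)).det.re := by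
  obtain ⟨B, hB⟩ := exists_eq_mul_conjTranspose_square Ψ
  rw [hB]
  obtain ⟨U, hU, V, hV, h⟩ := exists_mixFun_nonpos B
  have hmem := mem_ensValues (B * Uᵀ)
  have hUU : Uᵀ * (Uᵀ)ᴴ = 1 := by
    have := congrArg transpose (mem_unitaryGroup_iff'.1 hU)
    rw [transpose_mul, transpose_one, star_eq_conjTranspose] at this
    rw [← this]; rfl
  rw [conjTranspose_mul, Matrix.mul_assoc, ← Matrix.mul_assoc Uᵀ, hUU, Matrix.one_mul] at hmem
  refine ⟨_, hmem, V, hV, ?_⟩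
  rw [mixFun, ← branchDM_sub] at h
  rw [← branchDM_add V hV]
  have hdet : ∀ X Y : Matrix (Fin 2) (Fin 2) ℂ,
      (X + Y).det + (X - Y).det = 2 * X.det + 2 * Y.det := by
    intro X Y
    simp only [det_fin_two, Matrix.add_apply, Matrix.sub_apply]
    ring
  have h2 := congrArg Complex.re (hdet (branchDM V 0 (B * Bᴴ)) (branchDM V 1 (B * Bᴴ)))
  simp at h2
  linarith

open Matrix in
/-- The Frobenius norm of the Gram matrix of the polarized determinant is bounded by an average
concurrence value of the ensemble. -/
lemma exists_ensValues_frobenius {F : Type} [Fintype F] (Ψ : Matrix (Fin 2 × Fin 2) F ℂ) :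
    ∃ α ∈ ensValues (Ψ * Ψᴴ), ∑ f, ∑ g, ‖(Ψᵀ * spinFlip * Ψ) f g‖ ^ 2 ≤ α ^ 2 := by
  classical
  obtain ⟨U, hU, μ, hμ, hdiag⟩ := exists_takagi (Ψᵀ * spinFlip * Ψ) (by
    rw [transpose_mul, transpose_mul, transpose_transpose, spinFlip_transpose, Matrix.mul_assoc])
  have hτ : (Ψ * Uᵀ)ᵀ * spinFlip * (Ψ * Uᵀ) = diagonal fun i => (μ i : ℂ) := by
    rw [← hdiag, transpose_mul, transpose_transpose]; simp only [Matrix.mul_assoc]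
  have hUU : Uᵀ * (Uᵀ)ᴴ = 1 := by
    have := congrArg transpose (mem_unitaryGroup_iff'.1 hU)
    rw [transpose_mul, transpose_one, star_eq_conjTranspose] at this
    rw [← this]; rfl
  have hmem := mem_ensValues (Ψ * Uᵀ)
  rw [conjTranspose_mul, Matrix.mul_assoc, ← Matrix.mul_assoc Uᵀ, hUU, Matrix.one_mul] at hmem
  refine ⟨_, hmem, ?_⟩
  have hdet : ∀ k, 2 * ‖(colMat (Ψ * Uᵀ) k).det‖ = μ k := by
    intro k
    have h := trace_adjugate_colMat (Ψ * Uᵀ) k k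
    rw [adjugate_mul, hτ, diagonal_apply_eq] at h
    simp at h
    have h2 := congrArg norm h
    rw [norm_mul, Complex.norm_real, Real.norm_of_nonneg (hμ k)] at h2
    simp at h2
    linarith
  simp_rw [hdet]
  have hfrob : ∀ M : Matrix F F ℂ, (M * Mᴴ).trace = ((∑ f, ∑ g, ‖M f g‖ ^ 2 : ℝ) : ℂ) := by
    intro M
    simp only [trace, diag, mul_apply, conjTranspose_apply]
    push_cast
    refine Finset.sum_congr rfl fun f _ => Finset.sum_congr rfl fun g _ => ?_
    rw [Complex.star_def, Complex.mul_conj, Complex.normSq_eq_norm_sq]; push_cast; rfl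
  have htr : ((diagonal fun i => (μ i : ℂ)) * (diagonal fun i => (μ i : ℂ))ᴴ).trace =
      ((Ψᵀ * spinFlip * Ψ) * (Ψᵀ * spinFlip * Ψ)ᴴ).trace := by
    rw [← hdiag]
    set τ := Ψᵀ * spinFlip * Ψ
    rw [conjTranspose_mul, conjTranspose_mul, Matrix.mul_assoc (U * τ), ← Matrix.mul_assoc Uᵀ,
      hUU, Matrix.one_mul, Matrix.mul_assoc U, trace_mul_comm, Matrix.mul_assoc τ,
      Matrix.mul_assoc τᴴ, ← star_eq_conjTranspose U, mem_unitaryGroup_iff'.1 hU, Matrix.mul_one]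
  rw [hfrob (Ψᵀ * spinFlip * Ψ), diagonal_conjTranspose, diagonal_mul_diagonal,
    trace_diagonal] at htr
  have : ∑ f, ∑ g, ‖(Ψᵀ * spinFlip * Ψ) f g‖ ^ 2 = ∑ i, μ i ^ 2 := by
    have h := congrArg Complex.re htr
    rw [Complex.ofReal_re] at h
    rw [← h, Complex.re_sum]
    refine Finset.sum_congr rfl fun i _ => ?_
    simp [pow_two]
  rw [this]
  exact Finset.sum_sq_le_sq_sum_of_nonneg fun i _ => hμ i

/-- Exchange the coordinates in `S` between two configurations. -/
def swapOn {ι : Type*} [DecidableEq ι] (S : Finset ι) (z : (ι → Fin 2) × (ι → Fin 2)) :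
    (ι → Fin 2) × (ι → Fin 2) :=
  (fun i => if i ∈ S then z.2 i else z.1 i, fun i => if i ∈ S then z.1 i else z.2 i)

section

variable {ι : Type*} [DecidableEq ι]

@[simp] lemma swapOn_swapOn_self (S : Finset ι) (z : (ι → Fin 2) × (ι → Fin 2)) :
    swapOn S (swapOn S z) = z := by
  ext i <;> by_cases h : i ∈ S <;> simp [swapOn, h]

lemma swapOn_comm (S T : Finset ι) (z : (ι → Fin 2) × (ι → Fin 2)) :
    swapOn S (swapOn T z) = swapOn T (swapOn S z) := by
  ext i <;> by_cases h : i ∈ S <;> by_cases h' : i ∈ T <;> simp [swapOn, h, h']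

lemma swapOn_union {S T : Finset ι} (h : Disjoint S T) (z : (ι → Fin 2) × (ι → Fin 2)) :
    swapOn (S ∪ T) z = swapOn S (swapOn T z) := by
  ext i <;> by_cases hS : i ∈ S <;> by_cases hT : i ∈ T <;>
    simp [swapOn, hS, hT] <;> exact absurd hT (Finset.disjoint_left.1 h hS)

/-- The permutation exchanging the coordinates in `S`. -/
def swapEquiv (S : Finset ι) : (ι → Fin 2) × (ι → Fin 2) ≃ (ι → Fin 2) × (ι → Fin 2) :=
  ⟨swapOn S, swapOn S, swapOn_swapOn_self S, swapOn_swapOn_self S⟩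

variable [Fintype ι]

/-- The squared distance from `ω` to its transform under exchanging the coordinates in `S`. -/
def swapDist (ω : (ι → Fin 2) × (ι → Fin 2) → ℂ) (S : Finset ι) : ℝ :=
  ∑ z, ‖ω z - ω (swapOn S z)‖ ^ 2

lemma swapDist_nonneg (ω : (ι → Fin 2) × (ι → Fin 2) → ℂ) (S : Finset ι) : 0 ≤ swapDist ω S :=
  Finset.sum_nonneg fun _ _ => by positivity

lemma sum_comp_swapOn (S : Finset ι) (F : (ι → Fin 2) × (ι → Fin 2) → ℝ) :
    ∑ z, F (swapOn S z) = ∑ z, F z := (swapEquiv S).sum_comp F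

lemma norm_sq_quadrilateral (a b c d : ℂ) :
    ‖a - d‖ ^ 2 + ‖b - c‖ ^ 2 ≤ ‖a - b‖ ^ 2 + ‖c - d‖ ^ 2 + ‖a - c‖ ^ 2 + ‖b - d‖ ^ 2 := by
  simp only [← Complex.normSq_eq_norm_sq, Complex.normSq_apply, Complex.sub_re, Complex.sub_im]
  nlinarith [sq_nonneg (a.re - b.re - c.re + d.re), sq_nonneg (a.im - b.im - c.im + d.im)]

lemma swapDist_union_le (ω : (ι → Fin 2) × (ι → Fin 2) → ℂ) {S T : Finset ι} (h : Disjoint S T) :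
    swapDist ω (S ∪ T) ≤ swapDist ω S + swapDist ω T := by
  have h1 : ∑ z, ‖ω z - ω (swapOn S (swapOn T z))‖ ^ 2 = swapDist ω (S ∪ T) := by
    simp_rw [swapDist, swapOn_union h]
  have h2 : ∑ z, ‖ω (swapOn S z) - ω (swapOn T z)‖ ^ 2 = swapDist ω (S ∪ T) := by
    rw [← h1, ← sum_comp_swapOn S fun z => ‖ω z - ω (swapOn S (swapOn T z))‖ ^ 2]
    simp_rw [swapOn_comm S T, swapOn_swapOn_self]
  have h3 : ∑ z, ‖ω (swapOn T z) - ω (swapOn S (swapOn T z))‖ ^ 2 = swapDist ω S :=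
    sum_comp_swapOn T fun z => ‖ω z - ω (swapOn S z)‖ ^ 2
  have h4 : ∑ z, ‖ω (swapOn S z) - ω (swapOn S (swapOn T z))‖ ^ 2 = swapDist ω T := by
    simp_rw [swapOn_comm S T]
    exact sum_comp_swapOn S fun z => ‖ω z - ω (swapOn T z)‖ ^ 2
  have h5 := Finset.sum_le_sum fun z (_ : z ∈ Finset.univ) =>
    norm_sq_quadrilateral (ω z) (ω (swapOn S z)) (ω (swapOn T z)) (ω (swapOn S (swapOn T z)))
  simp only [Finset.sum_add_distrib] at h5
  rw [h1, h2, h3, h4] at h5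
  change _ ≤ swapDist ω S + _ + swapDist ω T + _ at h5
  linarith

@[simp] lemma swapDist_empty (ω : (ι → Fin 2) × (ι → Fin 2) → ℂ) : swapDist ω ∅ = 0 := by
  simp [swapDist, swapOn]

lemma swapDist_le_sum (ω : (ι → Fin 2) × (ι → Fin 2) → ℂ) (S : Finset ι) :
    swapDist ω S ≤ ∑ i ∈ S, swapDist ω {i} := by
  induction S using Finset.induction_on with
  | empty => simp
  | insert a S ha ih =>
    rw [Finset.sum_insert ha, Finset.insert_eq]
    exact (swapDist_union_le ω (Finset.disjoint_singleton_left.2 ha)).trans (by linarith)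

lemma swapDist_compl (ω : (ι → Fin 2) × (ι → Fin 2) → ℂ)
    (hω : ∀ z, ω (swapOn Finset.univ z) = ω z) (S : Finset ι) :
    swapDist ω Sᶜ = swapDist ω S := by
  refine Finset.sum_congr rfl fun z _ => ?_
  rw [← hω (swapOn Sᶜ z)]
  congr 4
  ext i <;> by_cases h : i ∈ S <;> simp [swapOn, h]

/-- Two copies of a state vector. -/
def twoCopies (ψ : (ι → Fin 2) → ℂ) (z : (ι → Fin 2) × (ι → Fin 2)) : ℂ := ψ z.1 * ψ z.2

lemma twoCopies_swapOn_univ (ψ : (ι → Fin 2) → ℂ) (z : (ι → Fin 2) × (ι → Fin 2)) :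
    twoCopies ψ (swapOn Finset.univ z) = twoCopies ψ z := by
  simp [twoCopies, swapOn, mul_comm]

end

lemma qubitCut_sq {N : ℕ} (P : Fin N → Prop) [DecidablePred P] (ψ : (Fin N → Fin 2) → ℂ)
    (hψ : ∑ x, ‖ψ x‖ ^ 2 = 1) :
    qubitCut P ψ ^ 2 = swapDist (twoCopies ψ) (Finset.univ.filter P) := by
  let e := Equiv.piEquivPiSubtypeProd P fun _ => Fin 2
  have h := sum_norm_sq_minor fun x => ψ (e.symm x)
  have hn : ∑ x, ‖ψ (e.symm x)‖ ^ 2 = 1 := by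
    rw [← hψ]; exact e.symm.sum_comp fun x => ‖ψ x‖ ^ 2
  rw [hn, one_pow] at h
  rw [qubitCut, pureConc]
  change Real.sqrt (2 * (1 - trSq (ptraceRight (pureDM fun x => ψ (e.symm x))))) ^ 2 = _
  rw [← h, Real.sq_sqrt (by positivity), ← Fintype.sum_prod_type', swapDist,
    ← (e.prodCongr e).symm.sum_comp]
  refine Finset.sum_congr rfl fun q _ => ?_
  simp only [twoCopies, swapOn, Equiv.prodCongr_symm, Equiv.prodCongr_apply, Prod.map]
  congr 5
  · ext i
    by_cases hi : P i <;> simp [e, Equiv.piEquivPiSubtypeProd, hi]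
  · ext i
    by_cases hi : P i <;> simp [e, Equiv.piEquivPiSubtypeProd, hi]

section

variable {N : ℕ}

/-- The conditional two-qubit vectors on `u, v`, as columns indexed by the other qubits. -/
def condMat (u v : Fin N) (ψ : (Fin N → Fin 2) → ℂ) :
    Matrix (Fin 2 × Fin 2) ({i : Fin N // i ≠ u ∧ i ≠ v} → Fin 2) ℂ :=
  Matrix.of fun x f => ψ (assemble2 u v x.1 x.2 f)

lemma condMat_apply (u v : Fin N) (ψ : (Fin N → Fin 2) → ℂ) (x : Fin 2 × Fin 2)
    (f : {i : Fin N // i ≠ u ∧ i ≠ v} → Fin 2) :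
    condMat u v ψ x f = ψ (assemble2 u v x.1 x.2 f) := rfl

lemma rdm2_eq_mul (u v : Fin N) (ψ : (Fin N → Fin 2) → ℂ) :
    rdm2 u v ψ = condMat u v ψ * (condMat u v ψ).conjTranspose := rfl

/-- Splitting a configuration into its values at two qubits and the rest. -/
def assembleEquiv {u v : Fin N} (h : u ≠ v) :
    (Fin 2 × Fin 2) × ({i : Fin N // i ≠ u ∧ i ≠ v} → Fin 2) ≃ (Fin N → Fin 2) where
  toFun q := assemble2 u v q.1.1 q.1.2 q.2
  invFun z := ((z u, z v), fun i => z i)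
  left_inv q := by
    ext i
    · simp [assemble2]
    · simp [assemble2, h.symm]
    · simp [assemble2, i.2.1, i.2.2]
  right_inv z := by
    funext i
    by_cases hu : i = u
    · simp [assemble2, hu]
    · by_cases hv : i = v
      · subst hv
        simp [assemble2, h.symm]
      · simp [assemble2, hu, hv]

lemma assembleEquiv_apply {u v : Fin N} (h : u ≠ v)
    (q : (Fin 2 × Fin 2) × ({i : Fin N // i ≠ u ∧ i ≠ v} → Fin 2)) :
    assembleEquiv h q = assemble2 u v q.1.1 q.1.2 q.2 := rfl

lemma trace_rdm2 {u v : Fin N} (h : u ≠ v) (ψ : (Fin N → Fin 2) → ℂ) :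
    (rdm2 u v ψ).trace = ((∑ x, ‖ψ x‖ ^ 2 : ℝ) : ℂ) := by
  rw [← (assembleEquiv h).sum_comp, Fintype.sum_prod_type]
  push_cast
  refine Finset.sum_congr rfl fun x _ => Finset.sum_congr rfl fun f _ => ?_
  rw [assembleEquiv_apply, Complex.mul_conj, Complex.normSq_eq_norm_sq]
  push_cast
  rfl

lemma swapOn_fst_assemble {u v : Fin N} (i j k l : Fin 2)
    (f g : {i : Fin N // i ≠ u ∧ i ≠ v} → Fin 2) :
    swapOn {u} (assemble2 u v i j f, assemble2 u v k l g) =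
      (assemble2 u v k j f, assemble2 u v i l g) := by
  ext m <;> by_cases hu : m = u <;> simp [swapOn, assemble2, hu]

lemma swapOn_snd_assemble {u v : Fin N} (h : u ≠ v) (i j k l : Fin 2)
    (f g : {i : Fin N // i ≠ u ∧ i ≠ v} → Fin 2) :
    swapOn {v} (assemble2 u v i j f, assemble2 u v k l g) =
      (assemble2 u v i l f, assemble2 u v k j g) := by
  ext m <;> by_cases hu : m = u <;> by_cases hv : m = v <;> simp_all [swapOn, assemble2]

lemma sum_pairs_assemble {M : Type*} [AddCommMonoid M] {u v : Fin N} (h : u ≠ v)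
    (F : (Fin N → Fin 2) × (Fin N → Fin 2) → M) :
    ∑ z, F z = ∑ f, ∑ g, ∑ x : Fin 2 × Fin 2, ∑ y : Fin 2 × Fin 2,
      F (assemble2 u v x.1 x.2 f, assemble2 u v y.1 y.2 g) := by
  rw [← (((Equiv.prodComm _ _).trans (Equiv.prodProdProdComm _ _ _ _)).trans
    ((assembleEquiv h).prodCongr (assembleEquiv h))).sum_comp, Fintype.sum_prod_type,
    Fintype.sum_prod_type]
  refine Finset.sum_congr rfl fun f _ => Finset.sum_congr rfl fun g _ => ?_
  rw [Fintype.sum_prod_type]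
  rfl

/-- The antisymmetrized double copy in qubit `a`. -/
def antisymCopies (a : Fin N) (ψ : (Fin N → Fin 2) → ℂ)
    (z : (Fin N → Fin 2) × (Fin N → Fin 2)) : ℂ :=
  twoCopies ψ z - twoCopies ψ (swapOn {a} z)

lemma swapDist_antisymCopies_self (a : Fin N) (ψ : (Fin N → Fin 2) → ℂ) :
    swapDist (antisymCopies a ψ) {a} = 4 * swapDist (twoCopies ψ) {a} := by
  rw [swapDist, swapDist, Finset.mul_sum]
  refine Finset.sum_congr rfl fun z _ => ?_
  have : antisymCopies a ψ z - antisymCopies a ψ (swapOn {a} z) =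
      2 * (twoCopies ψ z - twoCopies ψ (swapOn {a} z)) := by
    rw [antisymCopies, antisymCopies, swapOn_swapOn_self]; ring
  rw [this, norm_mul, mul_pow]; norm_num

lemma swapDist_antisymCopies {a v : Fin N} (h : a ≠ v) (ψ : (Fin N → Fin 2) → ℂ) :
    swapDist (antisymCopies a ψ) {v} =
      4 * ∑ f, ∑ g, ‖((condMat a v ψ).transpose * spinFlip * condMat a v ψ) f g‖ ^ 2 := by
  rw [swapDist, sum_pairs_assemble h, Finset.mul_sum]
  refine Finset.sum_congr rfl fun f _ => ?_
  rw [Finset.mul_sum]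
  refine Finset.sum_congr rfl fun g _ => ?_
  have hτ : ((condMat a v ψ).transpose * spinFlip * condMat a v ψ) f g =
      condMat a v ψ (0, 0) f * condMat a v ψ (1, 1) g +
        condMat a v ψ (1, 1) f * condMat a v ψ (0, 0) g -
        condMat a v ψ (0, 1) f * condMat a v ψ (1, 0) g -
        condMat a v ψ (1, 0) f * condMat a v ψ (0, 1) g := by
    simp [Matrix.mul_apply, Fintype.sum_prod_type, spinFlip_apply]
    ring
  rw [hτ]
  simp only [condMat_apply, antisymCopies, swapOn_snd_assemble h, swapOn_fst_assemble, twoCopies]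
  set p : Fin 2 → Fin 2 → ℂ := fun i j => ψ (assemble2 a v i j f)
  set q : Fin 2 → Fin 2 → ℂ := fun i j => ψ (assemble2 a v i j g)
  have key : ∀ x y : Fin 2 × Fin 2,
      ‖(p x.1 x.2 * q y.1 y.2 - p y.1 x.2 * q x.1 y.2) -
        (p x.1 y.2 * q y.1 x.2 - p y.1 y.2 * q x.1 x.2)‖ ^ 2 =
      if x.1 ≠ y.1 ∧ x.2 ≠ y.2 then
        ‖p 0 0 * q 1 1 + p 1 1 * q 0 0 - p 0 1 * q 1 0 - p 1 0 * q 0 1‖ ^ 2 else 0 := by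
    rintro ⟨i, j⟩ ⟨k, l⟩
    by_cases hik : i = k
    · subst hik
      simp
    by_cases hjl : j = l
    · subst hjl
      simp
    rw [if_pos ⟨hik, hjl⟩]
    congr 1
    obtain ⟨rfl, rfl⟩ | ⟨rfl, rfl⟩ : i = 0 ∧ k = 1 ∨ i = 1 ∧ k = 0 := by omega
    all_goals obtain ⟨rfl, rfl⟩ | ⟨rfl, rfl⟩ : j = 0 ∧ l = 1 ∨ j = 1 ∧ l = 0 := by omega
    · congr 1; ring
    · rw [← norm_neg]; congr 1; ring
    · rw [← norm_neg]; congr 1; ring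
    · congr 1; ring
  refine (Finset.sum_congr rfl fun x _ => Finset.sum_congr rfl fun y _ => key x y).trans ?_
  simp [Fintype.sum_prod_type]
  ring

/-- The dual monogamy relation. -/
lemma swapDist_le_sum_concA (a : Fin N) (ψ : (Fin N → Fin 2) → ℂ) (hψ : ∑ x, ‖ψ x‖ ^ 2 = 1) :
    swapDist (twoCopies ψ) {a} ≤ ∑ v ∈ {a}ᶜ, concA (rdm2 a v ψ) ^ 2 := by
  have hsym : ∀ z, antisymCopies a ψ (swapOn Finset.univ z) = antisymCopies a ψ z := by
    intro z
    rw [antisymCopies, swapOn_comm, twoCopies_swapOn_univ, twoCopies_swapOn_univ, antisymCopies]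
  have h := swapDist_le_sum (antisymCopies a ψ) {a}ᶜ
  rw [swapDist_compl _ hsym, swapDist_antisymCopies_self] at h
  have h2 : ∀ v ∈ ({a} : Finset (Fin N))ᶜ,
      swapDist (antisymCopies a ψ) {v} ≤ 4 * concA (rdm2 a v ψ) ^ 2 := by
    intro v hv
    have hav : a ≠ v := by
      simpa [eq_comm] using hv
    rw [swapDist_antisymCopies hav]
    obtain ⟨α, hα, hle⟩ := exists_ensValues_frobenius (condMat a v ψ)
    rw [← rdm2_eq_mul] at hα
    have h3 := le_concA_of_mem_ensValues (by rw [trace_rdm2 hav, hψ]; simp) hα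
    have h4 := pow_le_pow_left₀ (nonneg_of_mem_ensValues hα) h3 2
    linarith
  have h3 := Finset.sum_le_sum h2
  rw [← Finset.mul_sum] at h3
  linarith

end

lemma two_mul_sq_sub_trSq (R : Matrix (Fin 2) (Fin 2) ℂ) (s : ℝ) (h : R.trace = s) :
    2 * (s ^ 2 - trSq R) = 4 * R.det.re := by
  rw [Matrix.trace_fin_two] at h
  have h1 : (R * R).trace = s ^ 2 - 2 * R.det := by
    rw [Matrix.det_fin_two, Matrix.trace_fin_two, Matrix.mul_apply, Matrix.mul_apply,
      Fin.sum_univ_two, Fin.sum_univ_two, ← h]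
    ring
  rw [trSq, h1, ← Complex.ofReal_pow, Complex.sub_re, Complex.ofReal_re]
  have h2 : (2 * R.det).re = 2 * R.det.re := by simp
  rw [h2]
  ring

lemma trace_ptraceRight_pureDM {S T : Type*} [Fintype S] [Fintype T] (φ : S × T → ℂ) :
    (ptraceRight (pureDM φ)).trace = ((∑ x, ‖φ x‖ ^ 2 : ℝ) : ℂ) := by
  rw [Fintype.sum_prod_type]
  push_cast
  refine Finset.sum_congr rfl fun x _ => Finset.sum_congr rfl fun f _ => ?_
  rw [pureDM, Complex.mul_conj, Complex.normSq_eq_norm_sq]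
  push_cast
  rfl

section

variable {N : ℕ}

lemma swapDist_singleton {a v : Fin N} (h : a ≠ v) (ψ : (Fin N → Fin 2) → ℂ) :
    swapDist (twoCopies ψ) {a} = 4 * (ptraceRight (rdm2 a v ψ)).det.re := by
  set φ : Fin 2 × (Fin 2 × ({i : Fin N // i ≠ a ∧ i ≠ v} → Fin 2)) → ℂ :=
    fun x => ψ (assemble2 a v x.1 x.2.1 x.2.2) with hφ
  have h1 : ptraceRight (rdm2 a v ψ) = ptraceRight (pureDM φ) := by
    ext i j
    simp only [ptraceRight, pureDM, Fintype.sum_prod_type]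
    rfl
  rw [h1, ← two_mul_sq_sub_trSq _ _ (trace_ptraceRight_pureDM φ), ← sum_norm_sq_minor, swapDist,
    ← (((Equiv.prodAssoc _ _ _).symm.trans (assembleEquiv h)).prodCongr
    ((Equiv.prodAssoc _ _ _).symm.trans (assembleEquiv h))).sum_comp, Fintype.sum_prod_type]
  refine Finset.sum_congr rfl fun x _ => Finset.sum_congr rfl fun y _ => ?_
  congr 2
  simp only [Equiv.prodCongr_apply, Prod.map_apply, Equiv.trans_apply, assembleEquiv_apply,
    swapOn_fst_assemble, Equiv.prodAssoc_symm_apply, twoCopies, hφ]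

/-- The branch of `ψ` in which the qubit `v` is projected on the vector `w` and reset to `0`. -/
def branch (v : Fin N) (w : Fin 2 → ℂ) (ψ : (Fin N → Fin 2) → ℂ) (z : Fin N → Fin 2) : ℂ :=
  if z v = 0 then ∑ b, w b * ψ (Function.update z v b) else 0

lemma branch_zero_assemble {a v : Fin N} (h : a ≠ v) (w : Fin 2 → ℂ) (ψ : (Fin N → Fin 2) → ℂ)
    (i b : Fin 2) (f : {i : Fin N // i ≠ a ∧ i ≠ v} → Fin 2) :
    branch v w ψ (assemble2 a v i b f) =
      if b = 0 then ∑ c, w c * ψ (assemble2 a v i c f) else 0 := by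
  have h1 : assemble2 a v i b f v = b := by simp [assemble2, h.symm]
  have h2 (c : Fin 2) : Function.update (assemble2 a v i b f) v c = assemble2 a v i c f := by
    ext m
    by_cases hm : m = v
    · subst hm
      simp [assemble2, h.symm]
    · simp [assemble2, hm]
  simp only [branch, h1, h2]

lemma ptraceRight_rdm2_branch {a v : Fin N} (h : a ≠ v) (V : Matrix (Fin 2) (Fin 2) ℂ) (m : Fin 2)
    (ψ : (Fin N → Fin 2) → ℂ) :
    ptraceRight (rdm2 a v (branch v (fun b => V b m) ψ)) = branchDM V m (rdm2 a v ψ) := by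
  ext i j
  rw [branchDM_apply]
  simp only [ptraceRight, rdm2, branch_zero_assemble h, Fin.sum_univ_two]
  simp [Finset.mul_sum, ← Finset.sum_add_distrib]
  refine Finset.sum_congr rfl fun f _ => ?_
  ring

lemma exists_branches {a v : Fin N} (h : a ≠ v) (ψ : (Fin N → Fin 2) → ℂ) :
    ∃ α ∈ ensValues (rdm2 a v ψ), ∃ V ∈ Matrix.unitaryGroup (Fin 2) ℂ,
      α ^ 2 + 2 * (swapDist (twoCopies (branch v (fun b => V b 0) ψ)) {a} +
        swapDist (twoCopies (branch v (fun b => V b 1) ψ)) {a}) ≤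
        swapDist (twoCopies ψ) {a} := by
  obtain ⟨α, hα, V, hV, hle⟩ := exists_ensValues_branchDM (condMat a v ψ)
  rw [← rdm2_eq_mul] at hα hle
  refine ⟨α, hα, V, hV, ?_⟩
  rw [swapDist_singleton h, swapDist_singleton h, swapDist_singleton h,
    ptraceRight_rdm2_branch h, ptraceRight_rdm2_branch h]
  linarith

lemma sum_update {ι M : Type*} [Fintype ι] [DecidableEq ι] [AddCommMonoid M] (j : ι)
    (G : (ι → Fin 2) → M) :
    ∑ f, G f = ∑ f : ι → Fin 2, if f j = 0 then ∑ b, G (Function.update f j b) else 0 := by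
  rw [← Finset.sum_filter, Finset.sum_comm' (t' := Finset.univ)
    (s' := fun _ => Finset.univ.filter fun f : ι → Fin 2 => f j = 0) (by simp),
    ← Finset.sum_fiberwise (Finset.univ) (fun f : ι → Fin 2 => f j)]
  refine Finset.sum_congr rfl fun b _ => ?_
  refine Finset.sum_nbij' (fun f => Function.update f j 0) (fun f => Function.update f j b) ?_ ?_ ?_
    ?_ ?_ <;> intro f hf <;> simp at hf ⊢ <;> simp [← hf]

lemma rdm2_branch_add {a u v : Fin N} (hav : a ≠ v) (huv : u ≠ v)
    {V : Matrix (Fin 2) (Fin 2) ℂ} (hV : V ∈ Matrix.unitaryGroup (Fin 2) ℂ)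
    (ψ : (Fin N → Fin 2) → ℂ) :
    rdm2 a u (branch v (fun b => V b 0) ψ) + rdm2 a u (branch v (fun b => V b 1) ψ) =
      rdm2 a u ψ := by
  have hV' := (Matrix.mem_unitaryGroup_iff).1 hV
  have e (b c : Fin 2) : V b 0 * star (V c 0) + V b 1 * star (V c 1) = if b = c then 1 else 0 := by
    have := congrFun (congrFun hV' b) c
    simpa [Matrix.mul_apply, Fin.sum_univ_two, Matrix.one_apply, Matrix.star_apply] using this
  have e00 := e 0 0
  have e01 := e 0 1
  have e10 := e 1 0
  have e11 := e 1 1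
  ext x y
  rw [Matrix.add_apply, rdm2, rdm2, rdm2, ← Finset.sum_add_distrib]
  conv_rhs => rw [sum_update (⟨v, hav.symm, huv.symm⟩ : {i : Fin N // i ≠ a ∧ i ≠ u})]
  refine Finset.sum_congr rfl fun f _ => ?_
  have h1 (i j : Fin 2) : assemble2 a u i j f v = f ⟨v, hav.symm, huv.symm⟩ := by
    simp [assemble2, hav.symm, huv.symm]
  have h2 (i j c : Fin 2) : Function.update (assemble2 a u i j f) v c =
      assemble2 a u i j (Function.update f ⟨v, hav.symm, huv.symm⟩ c) := by
    ext m
    by_cases hm : m = v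
    · subst hm
      simp [assemble2, hav.symm, huv.symm]
    · simp [assemble2, hm]
  simp only [branch, h1, h2]
  by_cases hf : f ⟨v, hav.symm, huv.symm⟩ = 0
  · rw [if_pos rfl] at e00 e11
    rw [if_neg (by decide)] at e01 e10
    simp only [hf, if_true, Fin.sum_univ_two, map_add, map_mul, starRingEnd_apply]
    set p := fun c => ψ (assemble2 a u x.1 x.2 (Function.update f ⟨v, hav.symm, huv.symm⟩ c))
    set q := fun c => ψ (assemble2 a u y.1 y.2 (Function.update f ⟨v, hav.symm, huv.symm⟩ c))
    change (V 0 0 * p 0 + V 1 0 * p 1) * (star (V 0 0) * star (q 0) + star (V 1 0) * star (q 1)) +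
      (V 0 1 * p 0 + V 1 1 * p 1) * (star (V 0 1) * star (q 0) + star (V 1 1) * star (q 1)) =
      p 0 * star (q 0) + p 1 * star (q 1)
    linear_combination p 0 * star (q 0) * e00 + p 0 * star (q 1) * e01 +
      p 1 * star (q 0) * e10 + p 1 * star (q 1) * e11
  · simp [hf]

lemma exists_monogamy {a : Fin N} (S : Finset (Fin N)) (ha : a ∉ S) (ψ : (Fin N → Fin 2) → ℂ) :
    ∃ α : Fin N → ℝ, (∀ v ∈ S, α v ∈ ensValues (rdm2 a v ψ)) ∧
      ∑ v ∈ S, α v ^ 2 ≤ swapDist (twoCopies ψ) {a} := by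
  induction S using Finset.induction_on generalizing ψ with
  | empty => exact ⟨0, by simp, by simpa using swapDist_nonneg _ _⟩
  | insert v S hv ih =>
    rw [Finset.mem_insert, not_or] at ha
    obtain ⟨α, hα, V, hV, hle⟩ := exists_branches ha.1 ψ
    obtain ⟨β, hβ, hβle⟩ := ih ha.2 (branch v (fun b => V b 0) ψ)
    obtain ⟨γ, hγ, hγle⟩ := ih ha.2 (branch v (fun b => V b 1) ψ)
    refine ⟨fun u => if u = v then α else β u + γ u, fun u hu => ?_, ?_⟩
    · dsimp only
      split_ifs with h
      · exact h ▸ hα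
      · have huS := (Finset.mem_insert.1 hu).resolve_left h
        rw [← rdm2_branch_add ha.1 h hV ψ]
        exact add_mem_ensValues (hβ u huS) (hγ u huS)
    · simp only [Finset.sum_insert hv, if_true]
      have h1 : ∑ u ∈ S, (if u = v then α else β u + γ u) ^ 2 ≤
          ∑ u ∈ S, (2 * β u ^ 2 + 2 * γ u ^ 2) := by
        refine Finset.sum_le_sum fun u hu => ?_
        rw [if_neg (ne_of_mem_of_not_mem hu hv)]
        nlinarith [sq_nonneg (β u - γ u)]
      rw [Finset.sum_add_distrib, ← Finset.mul_sum, ← Finset.mul_sum] at h1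
      linarith

/-- The monogamy relation. -/
lemma sum_conc_le_swapDist (a : Fin N) (ψ : (Fin N → Fin 2) → ℂ) (hψ : ∑ x, ‖ψ x‖ ^ 2 = 1) :
    ∑ v ∈ {a}ᶜ, conc (rdm2 a v ψ) ^ 2 ≤ swapDist (twoCopies ψ) {a} := by
  obtain ⟨α, hα, hle⟩ := exists_monogamy (a := a) {a}ᶜ (by simp) ψ
  refine (Finset.sum_le_sum fun v hv => ?_).trans hle
  have hav : a ≠ v := by
    simpa [eq_comm] using hv
  exact pow_le_pow_left₀ (conc_nonneg _)
    (conc_le_of_mem_ensValues (by rw [trace_rdm2 hav, hψ]; simp) (hα v hv)) 2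

lemma assemble2_comm {u v : Fin N} (h : u ≠ v) (i j : Fin 2)
    (f : {i : Fin N // i ≠ u ∧ i ≠ v} → Fin 2) :
    assemble2 v u j i (fun m => f ⟨m, m.2.2, m.2.1⟩) = assemble2 u v i j f := by
  ext m
  by_cases hu : m = u
  · subst hu
    simp [assemble2, h]
  · by_cases hv : m = v
    · subst hv
      simp [assemble2, hu]
    · simp [assemble2, hu, hv]

lemma rdm2_comm {u v : Fin N} (h : u ≠ v) (ψ : (Fin N → Fin 2) → ℂ) (x y : Fin 2 × Fin 2) :
    rdm2 v u ψ x y = rdm2 u v ψ x.swap y.swap := by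
  symm
  refine Fintype.sum_equiv (Equiv.arrowCongr (Equiv.subtypeEquivRight fun m => and_comm)
    (Equiv.refl _)) _ _ fun f => ?_
  rw [← assemble2_comm h, ← assemble2_comm h]
  rfl

lemma pureConc_comp_swap (φ : Fin 2 × Fin 2 → ℂ) (hφ : ∑ x, ‖φ x‖ ^ 2 = 1) :
    pureConc (fun x => φ x.swap) = pureConc φ := by
  rw [pureConc_eq_norm_det φ hφ, pureConc_eq_norm_det (fun x => φ x.swap)
    (((Equiv.prodComm _ _).sum_comp fun x => ‖φ x‖ ^ 2).trans hφ)]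
  congr 2
  simp only [Prod.swap_prod_mk]
  ring

lemma concSet_subset_of_comm {ρ σ : Matrix (Fin 2 × Fin 2) (Fin 2 × Fin 2) ℂ}
    (h : ∀ x y, ρ x y = σ x.swap y.swap) : concSet σ ⊆ concSet ρ := by
  rintro c ⟨n, p, φ, hp, hp1, hφ, hσ, rfl⟩
  refine ⟨n, p, fun i x => φ i x.swap, hp, hp1, fun i => ?_, ?_, ?_⟩
  · exact ((Equiv.prodComm _ _).sum_comp fun x => ‖φ i x‖ ^ 2).trans (hφ i)
  · ext x y
    rw [h, hσ, Matrix.sum_apply, Matrix.sum_apply]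
    rfl
  · exact Finset.sum_congr rfl fun i _ => by rw [pureConc_comp_swap _ (hφ i)]

lemma concSet_rdm2_comm {u v : Fin N} (h : u ≠ v) (ψ : (Fin N → Fin 2) → ℂ) :
    concSet (rdm2 v u ψ) = concSet (rdm2 u v ψ) :=
  (concSet_subset_of_comm (rdm2_comm h.symm ψ)).antisymm
    (concSet_subset_of_comm (rdm2_comm h ψ))

lemma conc_rdm2_comm {u v : Fin N} (h : u ≠ v) (ψ : (Fin N → Fin 2) → ℂ) :
    conc (rdm2 v u ψ) = conc (rdm2 u v ψ) := by
  rw [conc, conc, concSet_rdm2_comm h]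

lemma concA_rdm2_comm {u v : Fin N} (h : u ≠ v) (ψ : (Fin N → Fin 2) → ℂ) :
    concA (rdm2 v u ψ) = concA (rdm2 u v ψ) := by
  rw [concA, concA, concSet_rdm2_comm h]

/-- The three-qubit cut is bounded below by one-qubit cuts. -/
lemma swapDist_le_qubitCut_sq {u v w : Fin N} (huv : u ≠ v) (huw : u ≠ w) (hvw : v ≠ w)
    (P : Fin N → Prop) [DecidablePred P] (hP : ∀ m, P m ↔ m = u ∨ m = v ∨ m = w)
    (ψ : (Fin N → Fin 2) → ℂ) (hψ : ∑ x, ‖ψ x‖ ^ 2 = 1) :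
    swapDist (twoCopies ψ) {w} ≤
      qubitCut P ψ ^ 2 + swapDist (twoCopies ψ) {u} + swapDist (twoCopies ψ) {v} := by
  have hS : ({w} : Finset (Fin N))ᶜ = (Finset.univ.filter P)ᶜ ∪ ({u} ∪ {v}) := by
    ext m
    by_cases hu : m = u <;> by_cases hv : m = v <;> by_cases hw : m = w <;> simp_all
  rw [qubitCut_sq P ψ hψ, ← swapDist_compl _ (twoCopies_swapOn_univ ψ) {w},
    ← swapDist_compl _ (twoCopies_swapOn_univ ψ) (Finset.univ.filter P), hS]
  have h1 := swapDist_union_le (twoCopies ψ) (S := (Finset.univ.filter P)ᶜ) (T := {u} ∪ {v})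
    (by simp +contextual [Finset.disjoint_left, hP])
  have h2 := swapDist_union_le (twoCopies ψ) (S := {u}) (T := {v}) (by simpa using huv)
  linarith

end

lemma sum_compl_singleton {n : ℕ} (F : Fin (n + 4) → ℝ) (a : Fin (n + 4)) :
    ∑ v ∈ {a}ᶜ, F v = F 0 + F 1 + F 2 + (∑ i : Fin (n + 1), F ⟨i + 3, by omega⟩) - F a := by
  have h := Finset.sum_compl_add_sum {a} F
  rw [Finset.sum_singleton, Fin.sum_univ_succ, Fin.sum_univ_succ, Fin.sum_univ_succ] at h
  have e : ∀ i : Fin (n + 1), (⟨i + 3, by omega⟩ : Fin (n + 4)) = i.succ.succ.succ := fun i => rfl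
  simp_rw [e]
  have e1 : (0 : Fin (n + 3)).succ = 1 := rfl
  have e2 : (0 : Fin (n + 2)).succ.succ = 2 := rfl
  rw [e1, e2] at h
  linarith

/-- Corollary 2 of the paper (lower bound) for the concurrence across the cut
`ABC₁ | C₂…C_{N-2}`.  Qubits: `A = 0`, `B = 1`, `C₁ = 2`, `C_i = i + 1`. -/
theorem corollary2_lower_bound
    (N : ℕ) (hN : 4 ≤ N) (ψ : (Fin N → Fin 2) → ℂ)
    (hψ : ∑ x, ‖ψ x‖ ^ 2 = 1) :
    (qubitCut (fun i : Fin N => (i : ℕ) < 3) ψ) ^ 2 ≥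
      (conc (rdm2 (⟨0, by omega⟩ : Fin N) (⟨2, by omega⟩ : Fin N) ψ)) ^ 2 + (conc (rdm2 (⟨1, by omega⟩ : Fin N) (⟨2, by omega⟩ : Fin N) ψ)) ^ 2 +
        (∑ i : Fin (N - 3), (conc (rdm2 (⟨2, by omega⟩ : Fin N) (⟨(i : ℕ) + 3, by have := i.isLt; omega⟩ : Fin N) ψ)) ^ 2) -
      2 * (concA (rdm2 (⟨0, by omega⟩ : Fin N) (⟨1, by omega⟩ : Fin N) ψ)) ^ 2 -
      ∑ i : Fin (N - 2),
        ((concA (rdm2 (⟨0, by omega⟩ : Fin N) (⟨(i : ℕ) + 2, by have := i.isLt; omega⟩ : Fin N) ψ)) ^ 2 + (concA (rdm2 (⟨1, by omega⟩ : Fin N) (⟨(i : ℕ) + 2, by have := i.isLt; omega⟩ : Fin N) ψ)) ^ 2) := by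
  obtain ⟨n, rfl⟩ : ∃ n, N = n + 4 := ⟨N - 4, by omega⟩
  have h01 : (0 : Fin (n + 4)) ≠ 1 := by simp
  have h02 : (0 : Fin (n + 4)) ≠ 2 := Fin.ne_of_val_ne (show 0 ≠ 2 by omega)
  have h12 : (1 : Fin (n + 4)) ≠ 2 := Fin.ne_of_val_ne (show 1 ≠ 2 by omega)
  have hcut := swapDist_le_qubitCut_sq h01 h02 h12 (fun i : Fin (n + 4) => (i : ℕ) < 3)
    (fun m => by
      rw [Fin.ext_iff, Fin.ext_iff, Fin.ext_iff]
      change (m : ℕ) < 3 ↔ (m : ℕ) = 0 ∨ (m : ℕ) = 1 ∨ (m : ℕ) = 2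
      omega) ψ hψ
  have hA := swapDist_le_sum_concA 0 ψ hψ
  have hB := swapDist_le_sum_concA 1 ψ hψ
  have hC := sum_conc_le_swapDist 2 ψ hψ
  rw [sum_compl_singleton fun v => concA (rdm2 0 v ψ) ^ 2] at hA
  rw [sum_compl_singleton fun v => concA (rdm2 1 v ψ) ^ 2, concA_rdm2_comm h01] at hB
  rw [sum_compl_singleton fun v => conc (rdm2 2 v ψ) ^ 2, conc_rdm2_comm h02,
    conc_rdm2_comm h12] at hC
  have hsplit : ∑ i : Fin (n + 4 - 2), (concA (rdm2 (0 : Fin (n + 4)) ⟨i + 2, by omega⟩ ψ) ^ 2 +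
      concA (rdm2 (1 : Fin (n + 4)) ⟨i + 2, by omega⟩ ψ) ^ 2) =
      concA (rdm2 0 2 ψ) ^ 2 + concA (rdm2 1 2 ψ) ^ 2 +
      (∑ i : Fin (n + 1), concA (rdm2 (0 : Fin (n + 4)) ⟨i + 3, by omega⟩ ψ) ^ 2 +
      ∑ i : Fin (n + 1), concA (rdm2 (1 : Fin (n + 4)) ⟨i + 3, by omega⟩ ψ) ^ 2) := by
    rw [← Finset.sum_add_distrib]
    exact Fin.sum_univ_succ (n := n + 1) _
  have hgoal : conc (rdm2 0 2 ψ) ^ 2 + conc (rdm2 1 2 ψ) ^ 2 +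
      (∑ i : Fin (n + 1), conc (rdm2 (2 : Fin (n + 4)) ⟨i + 3, by omega⟩ ψ) ^ 2) -
      2 * concA (rdm2 0 1 ψ) ^ 2 -
      ∑ i : Fin (n + 4 - 2), (concA (rdm2 (0 : Fin (n + 4)) ⟨i + 2, by omega⟩ ψ) ^ 2 +
      concA (rdm2 (1 : Fin (n + 4)) ⟨i + 2, by omega⟩ ψ) ^ 2) ≤
      qubitCut (fun i : Fin (n + 4) => (i : ℕ) < 3) ψ ^ 2 := by
    rw [hsplit]
    linarith
  exact hgoal

end
end

section
/- For any N-qubit pure state |ψ⟩ on qubits A, B, C₁, C₂, …, C_{N−2} (N ≥ 4), the squared concurrences across different cuts satisfy C²(|ψ⟩_{ABC₁|C₂…C_{N−2}}) ≥ C²(|ψ⟩_{AB|C₁C₂…C_{N−2}}) − C²(|ψ⟩_{C₁|ABC₂…C_{N−2}}). -/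
open scoped BigOperators

noncomputable section

open scoped ComplexConjugate

/-- Antisymmetrizing one factor of an inner product along an involution antisymmetrizes both. -/
lemma sum_conj_mul_sub_involutive {Ω : Type*} [Fintype Ω] (σ : Ω → Ω)
    (hσ : Function.Involutive σ) (a b : Ω → ℂ) :
    2 * ∑ p, conj (a p) * (b p - b (σ p)) =
      ∑ p, conj (a p - a (σ p)) * (b p - b (σ p)) := by
  have h : ∑ p, conj (a (σ p)) * (b (σ p) - b (σ (σ p))) =
      ∑ p, conj (a p) * (b p - b (σ p)) :=
    (Equiv.sum_comp hσ.toPerm fun p => conj (a p) * (b p - b (σ p)))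
  rw [two_mul]
  nth_rewrite 2 [← h]
  rw [← Finset.sum_add_distrib]
  refine Finset.sum_congr rfl fun p _ => ?_
  rw [hσ p, map_sub]
  ring

/-- The operator `(1 - σ) (1 - τ)` attached to commuting involutions is positive. -/
lemma re_sum_commuting_involutions_nonneg {Ω : Type*} [Fintype Ω] (σ τ : Ω → Ω)
    (hσ : Function.Involutive σ) (hτ : Function.Involutive τ)
    (hc : ∀ p, σ (τ p) = τ (σ p)) (φ : Ω → ℂ) :
    0 ≤ (∑ p, conj (φ p) * (φ p - φ (σ p) - φ (τ p) + φ (σ (τ p)))).re := by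
  have h1 := sum_conj_mul_sub_involutive σ hσ φ (fun p => φ p - φ (τ p))
  have h2 := sum_conj_mul_sub_involutive τ hτ (fun p => φ p - φ (σ p))
    (fun p => φ p - φ (σ p))
  have e1 : ∑ p, conj (φ p) * (φ p - φ (σ p) - φ (τ p) + φ (σ (τ p))) =
      ∑ p, conj (φ p) * (φ p - φ (τ p) - (φ (σ p) - φ (τ (σ p)))) := by
    refine Finset.sum_congr rfl fun p _ => ?_
    rw [hc]
    ring
  have e2 : ∑ p, conj (φ p - φ (σ p)) * (φ p - φ (τ p) - (φ (σ p) - φ (τ (σ p)))) =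
      ∑ p, conj (φ p - φ (σ p)) * (φ p - φ (σ p) - (φ (τ p) - φ (σ (τ p)))) := by
    refine Finset.sum_congr rfl fun p _ => ?_
    rw [hc]
    ring
  have h3 : 0 ≤ (∑ p, conj (φ p - φ (σ p) - (φ (τ p) - φ (σ (τ p)))) *
      (φ p - φ (σ p) - (φ (τ p) - φ (σ (τ p))))).re := by
    rw [Complex.re_sum]
    refine Finset.sum_nonneg fun p _ => ?_
    rw [← Complex.normSq_eq_conj_mul_self, Complex.ofReal_re]
    exact Complex.normSq_nonneg _
  have h4 : (4 : ℝ) * (∑ p, conj (φ p) * (φ p - φ (σ p) - φ (τ p) + φ (σ (τ p)))).re =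
      (∑ p, conj (φ p - φ (σ p) - (φ (τ p) - φ (σ (τ p)))) *
      (φ p - φ (σ p) - (φ (τ p) - φ (σ (τ p))))).re := by
    rw [← h2, ← e2, ← h1, ← e1]
    simp
    ring
  linarith

/-- Exchange the coordinates selected by `P` between two configurations. -/
def exchange {ι κ : Type*} (P : ι → Prop) [DecidablePred P]
    (p : (ι → κ) × (ι → κ)) : (ι → κ) × (ι → κ) :=
  (fun i => if P i then p.2 i else p.1 i, fun i => if P i then p.1 i else p.2 i)

lemma exchange_involutive {ι κ : Type*} (P : ι → Prop) [DecidablePred P] :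
    Function.Involutive (exchange (κ := κ) P) := by
  intro p
  ext i <;> by_cases h : P i <;> simp [exchange, h]

lemma exchange_comm {ι κ : Type*} (P Q : ι → Prop) [DecidablePred P] [DecidablePred Q]
    (p : (ι → κ) × (ι → κ)) : exchange P (exchange Q p) = exchange Q (exchange P p) := by
  ext i <;> by_cases h : P i <;> by_cases h' : Q i <;> simp [exchange, h, h']

/-- The purity of a reduced state is the expectation of an exchange on two copies. -/
lemma trSq_cut_eq {N : ℕ} (P : Fin N → Prop) [DecidablePred P] (ψ : (Fin N → Fin 2) → ℂ) :
    trSq (ptraceRight (pureDM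
      (fun x : ({i // P i} → Fin 2) × ({i // ¬ P i} → Fin 2) =>
        ψ ((Equiv.piEquivPiSubtypeProd P (fun _ => Fin 2)).symm x)))) =
    (∑ p : (Fin N → Fin 2) × (Fin N → Fin 2),
      conj (ψ p.1 * ψ p.2) * (ψ (exchange P p).1 * ψ (exchange P p).2)).re := by
  let e := (Equiv.piEquivPiSubtypeProd P (fun _ => Fin 2)).symm
  have key : ∀ s s' t t', exchange P (e (s, t), e (s', t')) = (e (s', t), e (s, t')) := by
    intro s s' t t'
    ext i <;> by_cases h : P i <;> simp [exchange, e, Equiv.piEquivPiSubtypeProd, h]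
  rw [trSq, ← Equiv.sum_comp (e.prodCongr e)]
  congr 1
  simp only [Matrix.trace, Matrix.diag, Matrix.mul_apply, ptraceRight, pureDM,
    Fintype.sum_prod_type, Equiv.prodCongr_apply, Prod.map_apply, key, Finset.sum_mul_sum]
  refine Finset.sum_congr rfl fun s _ => ?_
  conv_rhs => rw [Finset.sum_comm]
  refine Finset.sum_congr rfl fun s' _ => ?_
  rw [Finset.sum_comm]
  refine Finset.sum_congr rfl fun t _ => Finset.sum_congr rfl fun t' _ => ?_
  simp only [map_mul, e]
  ring

lemma qubitCut_sq_s11 {N : ℕ} (P : Fin N → Prop) [DecidablePred P] (ψ : (Fin N → Fin 2) → ℂ) :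
    qubitCut P ψ ^ 2 = max (2 * (1 - (∑ p : (Fin N → Fin 2) × (Fin N → Fin 2),
      conj (ψ p.1 * ψ p.2) * (ψ (exchange P p).1 * ψ (exchange P p).2)).re)) 0 := by
  rw [qubitCut, pureConc, trSq_cut_eq, Real.sq_sqrt']

/-- `C²(ψ_{ABC₁|C₂…}) ≥ C²(ψ_{AB|C₁C₂…}) - C²(ψ_{C₁|ABC₂…})`.
Qubits: `A = 0`, `B = 1`, `C₁ = 2`. -/
theorem cut_ABC1_lower_difference
    (N : ℕ) (hN : 4 ≤ N) (ψ : (Fin N → Fin 2) → ℂ)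
    (hψ : ∑ x, ‖ψ x‖ ^ 2 = 1) :
    (qubitCut (fun i : Fin N => (i : ℕ) < 3) ψ) ^ 2 ≥
      (qubitCut (fun i : Fin N => (i : ℕ) < 2) ψ) ^ 2 -
        (qubitCut (fun i : Fin N => i = (⟨2, by omega⟩ : Fin N)) ψ) ^ 2 := by
  have hnorm : (∑ p : (Fin N → Fin 2) × (Fin N → Fin 2),
      conj (ψ p.1 * ψ p.2) * (ψ p.1 * ψ p.2)).re = 1 := by
    rw [Complex.re_sum]
    have h : ∀ p : (Fin N → Fin 2) × (Fin N → Fin 2),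
        (conj (ψ p.1 * ψ p.2) * (ψ p.1 * ψ p.2)).re = ‖ψ p.1‖ ^ 2 * ‖ψ p.2‖ ^ 2 := by
      intro p
      rw [← Complex.normSq_eq_conj_mul_self, Complex.ofReal_re, Complex.normSq_eq_norm_sq,
        norm_mul, mul_pow]
    simp only [h, Fintype.sum_prod_type]
    rw [← Finset.sum_mul_sum, hψ, one_mul]
  have hpos := re_sum_commuting_involutions_nonneg
    (exchange (κ := Fin 2) fun i : Fin N => (i : ℕ) < 3)
    (exchange fun i : Fin N => i = (⟨2, by omega⟩ : Fin N))
    (exchange_involutive _) (exchange_involutive _) (exchange_comm _ _)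
    (fun p => ψ p.1 * ψ p.2)
  have hcomp : ∀ p : (Fin N → Fin 2) × (Fin N → Fin 2),
      exchange (fun i : Fin N => (i : ℕ) < 3)
        (exchange (fun i : Fin N => i = (⟨2, by omega⟩ : Fin N)) p) =
      exchange (fun i : Fin N => (i : ℕ) < 2) p := by
    intro p
    ext i <;> simp only [exchange, Fin.ext_iff] <;> split_ifs <;> first | rfl | omega
  simp only [hcomp, mul_add, mul_sub, Finset.sum_add_distrib, Finset.sum_sub_distrib,
    Complex.add_re, Complex.sub_re, hnorm] at hpos
  rw [qubitCut_sq_s11, qubitCut_sq_s11, qubitCut_sq_s11, ge_iff_le, tsub_le_iff_right]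
  refine max_le ?_ (add_nonneg (le_max_right _ _) (le_max_right _ _))
  refine le_trans ?_ (add_le_add (le_max_left _ _) (le_max_left _ _))
  linarith

end
end

section
/- Triangle inequality for linear entropy: for any density matrix ρ_{AB} on a finite-dimensional bipartite system H_A ⊗ H_B (a positive semidefinite matrix with trace 1), with reduced density matrices ρ_A = Tr_B(ρ_{AB}) and ρ_B = Tr_A(ρ_{AB}), the linear entropy T(ρ) = 1 − Tr(ρ²) satisfies |T(ρ_A) − T(ρ_B)| ≤ T(ρ_{AB}) ≤ T(ρ_A) + T(ρ_B). -/
open scoped BigOperators ComplexOrder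

noncomputable section

/-- A positive semidefinite kernel, twisted by a sign character of a Klein four-group of
permutations, has nonnegative twisted trace. -/
theorem Matrix.PosSemidef.sum_klein_four_nonneg {X : Type*} [Fintype X] {K : Matrix X X ℂ}
    (hK : K.PosSemidef) (σ τ : Equiv.Perm X) (hσ : ∀ x, σ (σ x) = x) (hτ : ∀ x, τ (τ x) = x)
    (hστ : ∀ x, σ (τ x) = τ (σ x)) (ε δ : ℝ) (hε : ε * ε = 1) (hδ : δ * δ = 1) :
    0 ≤ (∑ x, K x x).re + ε * (∑ x, K x (σ x)).re + δ * (∑ x, K x (τ x)).re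
      + ε * δ * (∑ x, K x (σ (τ x))).re := by
  have shift (π : Equiv.Perm X) (g : X → X) :
      ∑ x, (K (π x) (g (π x))).re = ∑ x, (K x (g x)).re :=
    Equiv.sum_comp π fun x => (K x (g x)).re
  have key (x : X) := (Complex.le_def.mp
    ((hK.submatrix ![x, σ x, τ x, σ (τ x)]).dotProduct_mulVec_nonneg
      ![1, (ε : ℂ), (δ : ℂ), (ε : ℂ) * δ])).1
  have total := Finset.sum_nonneg fun x (_ : x ∈ Finset.univ) => key x
  have row_σ_one := shift σ σ
  have row_τ_one := shift τ τ
  have row_σ_στ := shift σ τ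
  have row_τ_στ := shift τ σ
  have row_σ_τ := shift σ (fun x => σ (τ x))
  have row_τ_σ := shift τ (fun x => σ (τ x))
  have row_στ_one := shift (τ.trans σ) (fun x => σ (τ x))
  have row_στ_τ := shift (τ.trans σ) σ
  have row_στ_σ := shift (τ.trans σ) τ
  have diag_σ := shift σ id
  have diag_τ := shift τ id
  have diag_στ := shift (τ.trans σ) id
  simp only [hστ, hσ, hτ] at row_σ_one row_τ_one row_σ_στ row_τ_στ
  simp only [Equiv.trans_apply, hστ, hσ, hτ] at row_σ_τ row_τ_σ row_στ_one row_στ_τ row_στ_σ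
  simp only [Equiv.trans_apply, id, hστ] at diag_σ diag_τ diag_στ
  simp [Matrix.mulVec, dotProduct, Fin.sum_univ_four, Finset.sum_add_distrib, mul_add,
    ← Finset.mul_sum, ← Finset.sum_mul, hστ] at total
  simp only [Complex.re_sum, hστ]
  rw [row_σ_one, row_τ_one, row_σ_στ, row_τ_στ, row_σ_τ, row_τ_σ, row_στ_one,
    row_στ_τ, row_στ_σ, diag_σ, diag_τ, diag_στ] at total
  rcases mul_self_eq_one_iff.mp hε with rfl | rfl <;>
    rcases mul_self_eq_one_iff.mp hδ with rfl | rfl <;> linarith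

/-- Exchange of the first tensor factors between two copies of a bipartite index. -/
def swapFst (S T : Type*) : Equiv.Perm ((S × T) × (S × T)) where
  toFun x := ((x.2.1, x.1.2), (x.1.1, x.2.2))
  invFun x := ((x.2.1, x.1.2), (x.1.1, x.2.2))
  left_inv _ := rfl
  right_inv _ := rfl

/-- Exchange of the second tensor factors between two copies of a bipartite index. -/
def swapSnd (S T : Type*) : Equiv.Perm ((S × T) × (S × T)) where
  toFun x := ((x.1.1, x.2.2), (x.2.1, x.1.2))
  invFun x := ((x.1.1, x.2.2), (x.2.1, x.1.2))
  left_inv _ := rfl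
  right_inv _ := rfl

open scoped Kronecker in
/-- The signed combinations of global and marginal purities obtained from the (anti)symmetric
projections on two copies of the state are nonnegative. -/
theorem signed_purity_nonneg {A B : Type*} [Fintype A] [Fintype B]
    {ρ : Matrix (A × B) (A × B) ℂ} (hpsd : ρ.PosSemidef) (htr : ρ.trace = 1)
    (ε δ : ℝ) (hε : ε * ε = 1) (hδ : δ * δ = 1) :
    0 ≤ 1 + ε * trSq (ptraceRight ρ) + δ * trSq (ptraceLeft ρ) + ε * δ * trSq ρ := by
  have h := (hpsd.kronecker hpsd).sum_klein_four_nonneg (swapFst A B) (swapSnd A B)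
    (fun _ => rfl) (fun _ => rfl) (fun _ => rfl) ε δ hε hδ
  have hone : ∑ x, (ρ ⊗ₖ ρ) x x = 1 := by
    rw [← one_mul (1 : ℂ), ← htr, ← Matrix.trace_kronecker]
    rfl
  have hA : ∑ x, (ρ ⊗ₖ ρ) x (swapFst A B x) = (ptraceRight ρ * ptraceRight ρ).trace := by
    simp only [Matrix.trace, Matrix.diag, Matrix.mul_apply, ptraceRight, swapFst,
      Matrix.kroneckerMap_apply, Fintype.sum_prod_type, Equiv.coe_fn_mk, Finset.sum_mul_sum]
    exact Finset.sum_congr rfl fun _ _ => Finset.sum_comm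
  have hB : ∑ x, (ρ ⊗ₖ ρ) x (swapSnd A B x) = (ptraceLeft ρ * ptraceLeft ρ).trace := by
    simp only [Matrix.trace, Matrix.diag, Matrix.mul_apply, ptraceLeft, swapSnd,
      Matrix.kroneckerMap_apply, Fintype.sum_prod_type_right, Equiv.coe_fn_mk, Finset.sum_mul_sum]
    refine Finset.sum_congr rfl fun _ _ => Finset.sum_comm.trans ?_
    exact Finset.sum_congr rfl fun _ _ => Finset.sum_congr rfl fun _ _ =>
      Finset.sum_congr rfl fun _ _ => mul_comm _ _
  have hAB : ∑ x, (ρ ⊗ₖ ρ) x (swapFst A B (swapSnd A B x)) = (ρ * ρ).trace := by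
    simp only [Matrix.trace, Matrix.diag, Matrix.mul_apply, swapFst, swapSnd,
      Matrix.kroneckerMap_apply, Fintype.sum_prod_type, Equiv.coe_fn_mk]
  rw [hone, hA, hB, hAB, Complex.one_re] at h
  exact h

/-- Triangle inequality (and subadditivity) of the linear entropy
`T(ρ) = 1 - Tr(ρ²)` for a bipartite density matrix:
`|T(ρ_A) - T(ρ_B)| ≤ T(ρ_{AB}) ≤ T(ρ_A) + T(ρ_B)`. -/
theorem linear_entropy_triangle
    {A B : Type*} [Fintype A] [Fintype B]
    (ρ : Matrix (A × B) (A × B) ℂ)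
    (hpsd : ρ.PosSemidef) (htr : ρ.trace = 1) :
    |linEnt (ptraceRight ρ) - linEnt (ptraceLeft ρ)| ≤ linEnt ρ ∧
      linEnt ρ ≤ linEnt (ptraceRight ρ) + linEnt (ptraceLeft ρ) := by
  have hmm := signed_purity_nonneg hpsd htr (-1) (-1) (by norm_num) (by norm_num)
  have hpm := signed_purity_nonneg hpsd htr 1 (-1) (by norm_num) (by norm_num)
  have hmp := signed_purity_nonneg hpsd htr (-1) 1 (by norm_num) (by norm_num)
  unfold linEnt
  refine ⟨abs_le.mpr ⟨?_, ?_⟩, ?_⟩ <;> linarith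

end
end
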